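/- arXiv:1112.0819 — 2 statements merged into one kernel-verified Lean document; each statement's English description precedes it below -/
import Mathlib

section
/- If x ∈ 𝐊_{≤ℵ₀}, Y is an almost front of some member of ℬ_x, and Z ⊆ Y, then there exists y ∈ 𝐊_{≤ℵ₀} with x ≤_𝐊 y such that Z ∈ D^y_Y or Y \ Z ∈ D^y_Y. -/
open Set Cardinal

universe u

variable {α : Type u}

section OrderDefs

variable [PartialOrder α]

/-- `η` and `ν` are compatible in `M`: they have a common `≤`-upper bound in `M`. -/
def Compat (M : Set α) (η ν : α) : Prop :=
  ∃ ρ ∈ M, η ≤ ρ ∧ ν ≤ ρ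

/-- The set of immediate successors of `ν` inside `B`. -/
def succIn (B : Set α) (ν : α) : Set α :=
  {ρ ∈ B | ν < ρ ∧ ¬∃ σ ∈ B, ν < σ ∧ σ < ρ}

/-- The set of maximal elements of `B`. -/
def maxIn (B : Set α) : Set α :=
  {η ∈ B | ∀ ν ∈ B, ¬η < ν}

/-- `r` is the root (least element) of `B`. -/
def IsRoot (B : Set α) (r : α) : Prop :=
  r ∈ B ∧ ∀ x ∈ B, r ≤ x

/-- `B` is a countable well-founded subtree of `M`. -/
def CWT (M B : Set α) : Prop :=
  B ⊆ M ∧ B.Countable ∧ (∃ r, IsRoot B r) ∧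
  (∀ ν ∈ B, ∀ η ∈ B, ∀ ρ ∈ B, η ≤ ν → ρ ≤ ν → η ≤ ρ ∨ ρ ≤ η) ∧
  (∀ C, C ⊆ B → IsChain (· ≤ ·) C → C.Finite) ∧
  (∀ ν ∈ B, succIn B ν = ∅ ∨ (succIn B ν).Infinite) ∧
  (∀ η ∈ B, ∀ ν ∈ B, ¬η ≤ ν → ¬ν ≤ η → ¬Compat M η ν) ∧
  (∀ ν ∈ B \ maxIn B, ∀ F : Finset α, (F : Set α) ⊆ M \ {ρ | ρ ≤ ν} →
    {ϱ ∈ succIn B ν | ∀ ρ ∈ F, ¬Compat M ρ ϱ}.Infinite)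

/-- `Y` is a front of `B`: a maximal set of pairwise incomparable members of `B`. -/
def IsFront (B Y : Set α) : Prop :=
  Y ⊆ B ∧ (∀ η ∈ Y, ∀ ν ∈ Y, η ≠ ν → ¬η ≤ ν) ∧
  (∀ ν ∈ B, ∃ η ∈ Y, η ≤ ν ∨ ν ≤ η)

/-- `B'` is an exhaustive subtree of `B`. -/
def sb (M B B' : Set α) : Prop :=
  CWT M B' ∧ B' ⊆ B ∧ (∃ r, IsRoot B r ∧ IsRoot B' r) ∧
  ∀ ν ∈ B', succIn B' ν ⊆ succIn B ν ∧ (succIn B ν \ succIn B' ν).Finite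

/-- `B'` is a positive subtree of `B`. -/
def psb (M B B' : Set α) : Prop :=
  CWT M B' ∧ B' ⊆ B ∧ (∃ r, IsRoot B r ∧ IsRoot B' r) ∧
  ∀ ν ∈ B' \ maxIn B, (succIn B' ν).Infinite ∧ succIn B' ν ⊆ succIn B ν

/-- `Y` is an almost front of `B`: an antichain of `M` whose intersection with some
exhaustive subtree `B'` of `B` is a front of `B'`. -/
def IsAlmostFront (M B Y : Set α) : Prop :=
  Y ⊆ M ∧ (∀ η ∈ Y, ∀ ν ∈ Y, η ≠ ν → ¬η ≤ ν) ∧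
  ∃ B', sb M B B' ∧ IsFront B' (Y ∩ B')

/-- The relation `B₁ ≤*_M B₂`. -/
def leStar (M B₁ B₂ : Set α) : Prop :=
  CWT M B₁ ∧ CWT M B₂ ∧ (∃ r, IsRoot B₁ r ∧ IsRoot B₂ r) ∧
  ∃ B₂', sb M B₂ B₂' ∧ psb M B₁ (B₂' ∩ B₁) ∧
    ∀ Y, IsAlmostFront M (B₂' ∩ B₁) Y → IsAlmostFront M B₂ Y

end OrderDefs

section KDefs

variable (α) [PartialOrder α]

/-- A member of the class `𝐊`: a system of approximations to a system of ultrafilters. -/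
structure KSys where
  /-- the underlying set of the partial order `M_x` (the order is inherited from `α`) -/
  M : Set α
  /-- the root, i.e. the least element, of `M_x` -/
  rt : α
  rt_mem : rt ∈ M
  rt_least : ∀ a ∈ M, rt ≤ a
  /-- the system `⟨𝒜^x_η : η ∈ M_x⟩` -/
  A : α → Set (Set α)
  A_empty : ∀ η, η ∉ M → A η = ∅
  A_cwt : ∀ η ∈ M, ∀ B ∈ A η, CWT M B
  A_root : ∀ η ∈ M, ∀ B ∈ A η, IsRoot B η
  A_singleton : ∀ η ∈ M, {η} ∈ A η
  /-- the partial order `≤_x` on `ℬ_x = 𝒜^x_{rt} \ {{rt}}` -/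
  lex : Set α → Set α → Prop
  lex_mem : ∀ B₁ B₂, lex B₁ B₂ →
    B₁ ∈ A rt \ {({rt} : Set α)} ∧ B₂ ∈ A rt \ {({rt} : Set α)}
  lex_refl : ∀ B ∈ A rt \ {({rt} : Set α)}, lex B B
  lex_trans : ∀ B₁ B₂ B₃, lex B₁ B₂ → lex B₂ B₃ → lex B₁ B₃
  lex_antisymm : ∀ B₁ B₂, lex B₁ B₂ → lex B₂ B₁ → B₁ = B₂
  lex_directed : ∀ B₁ ∈ A rt \ {({rt} : Set α)}, ∀ B₂ ∈ A rt \ {({rt} : Set α)},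
    ∃ B₃ ∈ A rt \ {({rt} : Set α)}, lex B₁ B₃ ∧ lex B₂ B₃
  lex_leStar : ∀ B₁ B₂, lex B₁ B₂ → leStar M B₁ B₂
  A_restrict : ∀ η ∈ M, ∀ B ∈ A η, ∀ ν ∈ B, B ∩ {ρ | ν ≤ ρ} ∈ A ν

variable {α}

namespace KSys

/-- `ℬ_x = 𝒜^x_{rt_x} \ {{rt_x}}`. -/
def Bf (x : KSys α) : Set (Set α) :=
  x.A x.rt \ {({x.rt} : Set α)}

/-- The filter `D^x_Y` on an almost front `Y`. -/
def D (x : KSys α) (Y : Set α) : Set (Set α) :=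
  {Z | Z ⊆ Y ∧ ∃ B ∈ x.Bf, ∃ B', sb x.M B B' ∧ IsAlmostFront x.M B Y ∧ B' ∩ Y ⊆ Z}

/-- The ideal `id_x(ν,B)` on `suc_B(ν)`. -/
def idl (x : KSys α) (ν : α) (B : Set α) : Set (Set α) :=
  {C | C ⊆ succIn B ν ∧ ∃ F : Finset α, (F : Set α) ⊆ x.M \ {ρ | ν ≤ ρ} ∧
    ∀ ϱ ∈ C, ∃ ρ ∈ F, Compat x.M ϱ ρ}

/-- `‖x‖ = |M_x| + Σ {|𝒜^x_η| : η ∈ M_x}`. -/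
noncomputable def norm (x : KSys α) : Cardinal.{u} :=
  Cardinal.mk ↥x.M + Cardinal.sum fun η : ↥x.M => Cardinal.mk ↥(x.A ↑η)

end KSys

/-- The relation `x ≤_𝐊 y`. -/
def KLE (x y : KSys α) : Prop :=
  x.M ⊆ y.M ∧
  (∀ η ∈ x.M, ∀ ν ∈ x.M, (Compat x.M η ν ↔ Compat y.M η ν)) ∧
  (∀ η ∈ x.M, x.A η ⊆ y.A η) ∧
  y.rt = x.rt ∧
  (∀ B₁ ∈ x.Bf, ∀ B₂ ∈ x.Bf, (x.lex B₁ B₂ ↔ y.lex B₁ B₂))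

end KDefs

section Trees

variable [PartialOrder α] {M B C P Y Z : Set α} {r : α}

lemma Compat.mono {η ν η' ν' : α} (h : Compat M η' ν') (hη : η ≤ η') (hν : ν ≤ ν') :
    Compat M η ν := by
  obtain ⟨ρ, hρ, h1, h2⟩ := h
  exact ⟨ρ, hρ, hη.trans h1, hν.trans h2⟩

lemma Compat.symm {η ν : α} (h : Compat M η ν) : Compat M ν η := by
  obtain ⟨ρ, hρ, h1, h2⟩ := h
  exact ⟨ρ, hρ, h2, h1⟩

namespace CWT

lemma subset (h : CWT M B) : B ⊆ M := h.1

lemma comparable (h : CWT M B) {ν η ρ : α} (hν : ν ∈ B) (hη : η ∈ B) (hρ : ρ ∈ B)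
    (h1 : η ≤ ν) (h2 : ρ ≤ ν) : η ≤ ρ ∨ ρ ≤ η :=
  h.2.2.2.1 ν hν η hη ρ hρ h1 h2

lemma chain_finite (h : CWT M B) {S : Set α} (hS : S ⊆ B) (hc : IsChain (· ≤ ·) S) : S.Finite :=
  h.2.2.2.2.1 S hS hc

lemma succ_infinite (h : CWT M B) {ν : α} (hν : ν ∈ B) (hm : ν ∉ maxIn B) {F : Finset α}
    (hF : (F : Set α) ⊆ M \ {ρ | ρ ≤ ν}) :
    {ϱ ∈ succIn B ν | ∀ ρ ∈ F, ¬Compat M ρ ϱ}.Infinite :=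
  h.2.2.2.2.2.2.2 ν ⟨hν, hm⟩ F hF

lemma isChain_below (h : CWT M B) {ν : α} (hν : ν ∈ B) {S : Set α} (hS : S ⊆ B)
    (hS' : ∀ σ ∈ S, σ ≤ ν) : IsChain (· ≤ ·) S :=
  fun _ ha _ hb _ => h.comparable hν (hS ha) (hS hb) (hS' _ ha) (hS' _ hb)

lemma exists_succ_le (h : CWT M B) {η ν : α} (hν : ν ∈ B) (hlt : η < ν) :
    ∃ σ ∈ succIn B η, σ ≤ ν := by
  have hS : {σ ∈ B | η < σ ∧ σ ≤ ν}.Finite :=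
    h.chain_finite (fun _ hx => hx.1)
      (h.isChain_below hν (fun _ hx => hx.1) fun _ hx => hx.2.2)
  obtain ⟨σ, hσ⟩ := hS.exists_minimal ⟨ν, hν, hlt, le_rfl⟩
  refine ⟨σ, ⟨hσ.prop.1, hσ.prop.2.1, ?_⟩, hσ.prop.2.2⟩
  rintro ⟨τ, hτ, h1, h2⟩
  exact h2.not_ge (hσ.le_of_le ⟨hτ, h1, h2.le.trans hσ.prop.2.2⟩ h2.le)

/-- Among the members of a nonempty subset of a tree below a given node there is a last one. -/
lemma exists_last_below (h : CWT M B) {ν r : α} (hν : ν ∈ B) {S : Set α} (hS : S ⊆ B)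
    (hr : r ∈ S) (hrν : r ≤ ν) : ∃ κ ∈ S, κ ≤ ν ∧ ∀ c ∈ S, c ≤ ν → c ≤ κ := by
  have hf : {σ ∈ S | σ ≤ ν}.Finite :=
    h.chain_finite (fun _ hx => hS hx.1)
      (h.isChain_below hν (fun _ hx => hS hx.1) fun _ hx => hx.2)
  obtain ⟨κ, hκ⟩ := hf.exists_maximal ⟨r, hr, hrν⟩
  refine ⟨κ, hκ.prop.1, hκ.prop.2, fun c hc hcν => ?_⟩
  rcases h.comparable hν (hS hc) (hS hκ.prop.1) hcν hκ.prop.2 with h1 | h1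
  · exact h1
  · exact hκ.le_of_ge ⟨hc, hcν⟩ h1

lemma exists_max_ge (h : CWT M B) {ν : α} (hν : ν ∈ B) : ∃ τ ∈ maxIn B, ν ≤ τ := by
  obtain ⟨τ, hντ, hτ⟩ := zorn_le_nonempty₀ B (fun c hc hcc y hy => by
    obtain ⟨m, hm⟩ := (h.chain_finite hc hcc).exists_maximal ⟨y, hy⟩
    refine ⟨m, hc hm.prop, fun z hz => ?_⟩
    rcases hcc.total hz hm.prop with h1 | h1
    · exact h1
    · exact hm.le_of_ge hz h1) ν hν
  exact ⟨τ, ⟨hτ.prop, fun σ hσ hlt => hlt.not_ge (hτ.le_of_ge hσ hlt.le)⟩, hντ⟩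

lemma le_of_lt_succ (h : CWT M B) {ν σ c : α} (hν : ν ∈ B) (hσ : σ ∈ succIn B ν) (hc : c ∈ B)
    (hcσ : c < σ) : c ≤ ν := by
  rcases h.comparable hσ.1 hc hν hcσ.le hσ.2.1.le with h1 | h1
  · exact h1
  · rcases h1.eq_or_lt with h2 | h2
    · exact h2.ge
    · exact (hσ.2.2 ⟨c, hc, h2, hcσ⟩).elim

lemma cone (h : CWT M B) {ν : α} (hν : ν ∈ B) : CWT M (B ∩ {ρ | ν ≤ ρ}) := by
  have hs : ∀ σ, ν ≤ σ → succIn (B ∩ {ρ | ν ≤ ρ}) σ = succIn B σ := by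
    intro σ hσ
    ext ρ
    constructor
    · rintro ⟨h1, h2, h3⟩
      exact ⟨h1.1, h2, fun ⟨τ, t1, t2, t3⟩ => h3 ⟨τ, ⟨t1, hσ.trans t2.le⟩, t2, t3⟩⟩
    · rintro ⟨h1, h2, h3⟩
      exact ⟨⟨h1, hσ.trans h2.le⟩, h2, fun ⟨τ, t1, t2, t3⟩ => h3 ⟨τ, t1.1, t2, t3⟩⟩
  obtain ⟨h1, h2, h3, h4, h5, h6, h7, h8⟩ := h
  refine ⟨fun _ hx => h1 hx.1, h2.mono inter_subset_left, ⟨ν, ⟨hν, le_refl ν⟩, fun _ hx => hx.2⟩,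
    fun a ha b hb c hc => h4 a ha.1 b hb.1 c hc.1, fun S hS => h5 S fun _ hx => (hS hx).1,
    fun a ha => ?_, fun a ha b hb => h7 a ha.1 b hb.1, fun a ha F hF => ?_⟩
  · rw [hs a ha.2]
    exact h6 a ha.1
  · rw [hs a ha.1.2]
    exact h8 a ⟨ha.1.1, fun hm => ha.2 ⟨ha.1, fun b hb => hm.2 b hb.1⟩⟩ F hF

end CWT

/-- `P` is an initial segment of the tree `B` keeping a positive set of successors of every
non-maximal node. -/
structure PosSub (M B P : Set α) (r : α) : Prop where
  subset : P ⊆ B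
  root_mem : r ∈ P
  down : ∀ ν ∈ P, ∀ η ∈ B, η ≤ ν → η ∈ P
  pos : ∀ ν ∈ P, ν ∉ maxIn B → ∀ F : Finset α, (F : Set α) ⊆ M \ {ρ | ρ ≤ ν} →
    {ϱ ∈ succIn B ν ∩ P | ∀ ρ ∈ F, ¬Compat M ρ ϱ}.Infinite

/-- `E` is an initial segment of the tree `B` keeping almost all successors of every node. -/
structure ExSub (B E : Set α) (r : α) : Prop where
  subset : E ⊆ B
  root_mem : r ∈ E
  down : ∀ ν ∈ E, ∀ η ∈ B, η ≤ ν → η ∈ E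
  cofin : ∀ ν ∈ E, (succIn B ν \ E).Finite

lemma succIn_of_down (hP : P ⊆ B) (hd : ∀ ν ∈ P, ∀ η ∈ B, η ≤ ν → η ∈ P) (ν : α) :
    succIn P ν = succIn B ν ∩ P := by
  ext ρ
  constructor
  · rintro ⟨h1, h2, h3⟩
    exact ⟨⟨hP h1, h2, fun ⟨τ, t1, t2, t3⟩ => h3 ⟨τ, hd ρ h1 τ t1 t3.le, t2, t3⟩⟩, h1⟩
  · rintro ⟨⟨_, h2, h3⟩, h4⟩
    exact ⟨h4, h2, fun ⟨τ, t1, t2, t3⟩ => h3 ⟨τ, hP t1, t2, t3⟩⟩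

lemma ExSub.posSub {E : Set α} (hB : CWT M B) (h : ExSub B E r) : PosSub M B E r := by
  refine ⟨h.subset, h.root_mem, h.down, fun ν hν hm F hF => ?_⟩
  refine ((hB.succ_infinite (h.subset hν) hm hF).sdiff (h.cofin ν hν)).mono ?_
  rintro ϱ ⟨⟨h1, h2⟩, h3⟩
  refine ⟨⟨h1, ?_⟩, h2⟩
  by_contra h4
  exact h3 ⟨h1, h4⟩

lemma ExSub.refl (hr : r ∈ B) : ExSub B B r :=
  ⟨Subset.rfl, hr, fun _ _ _ h _ => h, fun ν _ => by
    rw [sdiff_eq_empty.2 fun _ hx => hx.1]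
    exact finite_empty⟩

lemma ExSub.inter {E E' : Set α} (h : ExSub B E r) (h' : ExSub B E' r) :
    ExSub B (E ∩ E') r :=
  ⟨fun _ hx => h.subset hx.1, ⟨h.root_mem, h'.root_mem⟩,
    fun ν hν η hη hle => ⟨h.down ν hν.1 η hη hle, h'.down ν hν.2 η hη hle⟩,
    fun ν hν => by
      rw [sdiff_inter]
      exact (h.cofin ν hν.1).union (h'.cofin ν hν.2)⟩

lemma ExSub.inter_posSub {E : Set α} (h : ExSub B E r) (hP : PosSub M B P r) :
    ExSub P (E ∩ P) r := by
  refine ⟨inter_subset_right, ⟨h.root_mem, hP.root_mem⟩,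
    fun ν hν η hη hle => ⟨h.down ν hν.1 η (hP.subset hη) hle, hη⟩, fun ν hν => ?_⟩
  rw [succIn_of_down hP.subset hP.down]
  refine (h.cofin ν hν.1).subset ?_
  rintro ϱ ⟨⟨h1, h2⟩, h3⟩
  exact ⟨h1, fun h4 => h3 ⟨h4, h2⟩⟩

namespace PosSub

lemma succIn_eq (h : PosSub M B P r) (ν : α) : succIn P ν = succIn B ν ∩ P :=
  succIn_of_down h.subset h.down ν

lemma succ_infinite (h : PosSub M B P r) {ν : α} (hν : ν ∈ P) (hm : ν ∉ maxIn B) :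
    (succIn P ν).Infinite := by
  rw [h.succIn_eq]
  exact (h.pos ν hν hm ∅ (by simp)).mono fun _ hx => hx.1

lemma maxIn_eq (h : PosSub M B P r) : maxIn P = maxIn B ∩ P := by
  ext τ
  constructor
  · intro hτ
    refine ⟨?_, hτ.1⟩
    by_contra hm
    obtain ⟨σ, hσ⟩ := (h.succ_infinite hτ.1 hm).nonempty
    exact hτ.2 σ hσ.1 hσ.2.1
  · rintro ⟨h1, h2⟩
    exact ⟨h2, fun σ hσ => h1.2 σ (h.subset hσ)⟩

lemma cwt (hB : CWT M B) (hr : IsRoot B r) (h : PosSub M B P r) : CWT M P := by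
  obtain ⟨h1, h2, h3, h4, h5, h6, h7, h8⟩ := hB
  have hmax : ∀ ν ∈ P, ν ∉ maxIn P → ν ∉ maxIn B := fun ν hν hm hm' =>
    hm (h.maxIn_eq ▸ ⟨hm', hν⟩)
  refine ⟨h.subset.trans h1, h2.mono h.subset,
    ⟨r, h.root_mem, fun x hx => hr.2 x (h.subset hx)⟩,
    fun a ha b hb c hc => h4 a (h.subset ha) b (h.subset hb) c (h.subset hc),
    fun S hS => h5 S (hS.trans h.subset), fun ν hν => ?_,
    fun a ha b hb => h7 a (h.subset ha) b (h.subset hb), fun ν hν F hF => ?_⟩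
  · by_cases hm : ν ∈ maxIn B
    · left
      ext σ
      simp only [mem_empty_iff_false, iff_false]
      exact fun hσ => hm.2 σ (h.subset hσ.1) hσ.2.1
    · exact Or.inr (h.succ_infinite hν hm)
  · rw [h.succIn_eq]
    exact h.pos ν hν.1 (hmax ν hν.1 hν.2) F hF

end PosSub

lemma down_of_succIn_subset (hB : CWT M B) (hP : CWT M P) (hsub : P ⊆ B) (hr : IsRoot B r)
    (hrP : r ∈ P) (hs : ∀ ν ∈ P, ν ∉ maxIn B → succIn P ν ⊆ succIn B ν) :
    ∀ ν ∈ P, ∀ η ∈ B, η ≤ ν → η ∈ P := by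
  intro ν hν η hη hle
  obtain ⟨σ, hσ, hση, hlast⟩ := hB.exists_last_below hη hsub hrP (hr.2 η hη)
  rcases hση.eq_or_lt with rfl | hlt
  · exact hσ
  obtain ⟨ϱ, hϱ, hϱν⟩ := hP.exists_succ_le hν (hlt.trans_le hle)
  have hϱ' := hs σ hσ (fun hm => hm.2 η hη hlt) hϱ
  rcases hB.comparable (hsub hν) hϱ'.1 hη hϱν hle with h1 | h1
  · exact ((hlast ϱ hϱ.1 h1).not_gt hϱ.2.1).elim
  · rcases h1.eq_or_lt with h2 | h2
    · exact h2 ▸ hϱ.1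
    · exact (hϱ'.2.2 ⟨η, hη, hlt, h2⟩).elim

lemma IsRoot.unique {r' : α} (h : IsRoot B r) (h' : IsRoot B r') : r = r' :=
  le_antisymm (h.2 _ h'.1) (h'.2 _ h.1)

lemma IsRoot.inter_eq (h : IsRoot B r) : B ∩ {ρ | r ≤ ρ} = B :=
  inter_eq_left.2 h.2

lemma sb_iff (hB : CWT M B) (hr : IsRoot B r) {E : Set α} : sb M B E ↔ ExSub B E r := by
  constructor
  · rintro ⟨h1, h2, ⟨r', h3, h4⟩, h5⟩
    obtain rfl := hr.unique h3
    have hd := down_of_succIn_subset hB h1 h2 hr h4.1 fun ν hν _ => (h5 ν hν).1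
    refine ⟨h2, h4.1, hd, fun ν hν => (h5 ν hν).2.subset ?_⟩
    rw [succIn_of_down h2 hd]
    exact fun x hx => ⟨hx.1, fun h => hx.2 h.2⟩
  · intro h
    refine ⟨(h.posSub hB).cwt hB hr, h.subset,
      ⟨r, hr, h.root_mem, fun x hx => hr.2 x (h.subset hx)⟩, fun ν hν => ?_⟩
    rw [succIn_of_down h.subset h.down]
    refine ⟨inter_subset_left, (h.cofin ν hν).subset ?_⟩
    exact fun x hx => ⟨hx.1, fun h' => hx.2 ⟨hx.1, h'⟩⟩

lemma psb_iff (hB : CWT M B) (hr : IsRoot B r) : psb M B P ↔ PosSub M B P r := by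
  constructor
  · rintro ⟨h1, h2, ⟨r', h3, h4⟩, h5⟩
    obtain rfl := hr.unique h3
    have hd := down_of_succIn_subset hB h1 h2 hr h4.1 fun ν hν hm => (h5 ν ⟨hν, hm⟩).2
    refine ⟨h2, h4.1, hd, fun ν hν hm F hF => ?_⟩
    rw [← succIn_of_down h2 hd]
    refine h1.succ_infinite hν (fun hm' => ?_) hF
    obtain ⟨σ, hσ⟩ := (h5 ν ⟨hν, hm⟩).1.nonempty
    exact hm'.2 σ hσ.1 hσ.2.1
  · intro h
    refine ⟨h.cwt hB hr, h.subset,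
      ⟨r, hr, h.root_mem, fun x hx => hr.2 x (h.subset hx)⟩, fun ν hν => ?_⟩
    refine ⟨h.succ_infinite hν.1 hν.2, ?_⟩
    rw [h.succIn_eq]
    exact inter_subset_left

/-- An antichain is an almost front when it meets every maximal branch of an exhaustive subtree. -/
lemma isAlmostFront_iff (hB : CWT M B) (hr : IsRoot B r) :
    IsAlmostFront M B Y ↔ Y ⊆ M ∧ (∀ η ∈ Y, ∀ ν ∈ Y, η ≠ ν → ¬η ≤ ν) ∧
      ∃ E, ExSub B E r ∧ ∀ τ ∈ maxIn B ∩ E, ∃ w ∈ Y ∩ B, w ≤ τ := by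
  refine and_congr_right fun _ => and_congr_right fun hanti => exists_congr fun E => ?_
  rw [sb_iff hB hr]
  refine and_congr_right fun hE => ?_
  have hP := hE.posSub hB
  constructor
  · rintro ⟨-, -, h⟩ τ hτ
    obtain ⟨w, hw, hle | hle⟩ := h τ hτ.2
    · exact ⟨w, ⟨hw.1, hE.subset hw.2⟩, hle⟩
    · rcases hle.eq_or_lt with rfl | hlt
      · exact ⟨τ, ⟨hw.1, hE.subset hw.2⟩, le_rfl⟩
      · exact (hτ.1.2 w (hE.subset hw.2) hlt).elim
  · intro h
    refine ⟨inter_subset_right, fun η hη ν hν => hanti η hη.1 ν hν.1, fun ν hν => ?_⟩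
    obtain ⟨τ, hτ, hle⟩ := (hP.cwt hB hr).exists_max_ge hν
    rw [hP.maxIn_eq] at hτ
    obtain ⟨w, hw, hwτ⟩ := h τ hτ
    exact ⟨w, ⟨hw.1, hE.down τ hτ.2 w hw.2 hwτ⟩,
      hB.comparable (hE.subset hτ.2) hw.2 (hE.subset hν) hwτ hle⟩

lemma IsAlmostFront.posSub (hB : CWT M B) (hr : IsRoot B r) (h : IsAlmostFront M B Y)
    (hP : PosSub M B P r) : IsAlmostFront M P Y := by
  have hrP : IsRoot P r := ⟨hP.root_mem, fun x hx => hr.2 x (hP.subset hx)⟩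
  rw [isAlmostFront_iff hB hr] at h
  rw [isAlmostFront_iff (hP.cwt hB hr) hrP]
  obtain ⟨h1, h2, E, hE, h3⟩ := h
  refine ⟨h1, h2, E ∩ P, hE.inter_posSub hP, fun τ hτ => ?_⟩
  rw [hP.maxIn_eq] at hτ
  obtain ⟨w, hw, hle⟩ := h3 τ ⟨hτ.1.1, hτ.2.1⟩
  exact ⟨w, ⟨hw.1, hP.down τ hτ.2.2 w hw.2 hle⟩, hle⟩

/-- `E` witnesses that `B` dominates `C`: it is an exhaustive subtree of `B`, its trace on `C` is
an initial segment of `C`, and all its maximal branches pass through maximal nodes of `C`. -/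
structure Dominates (C B E : Set α) (r : α) : Prop where
  exSub : ExSub B E r
  down : ∀ e ∈ E ∩ C, ∀ c ∈ C, c ≤ e → c ∈ E
  max : ∀ τ ∈ maxIn B ∩ E, ∃ μ ∈ maxIn C ∩ E, μ ≤ τ

lemma leStar.exists_dominates (h : leStar M C B) (hr : IsRoot B r) :
    ∃ E, Dominates C B E r := by
  obtain ⟨hC, hB, ⟨r', hrC, hrB⟩, B', hB', hpsb, hfr⟩ := h
  obtain rfl := hrB.unique hr
  rw [sb_iff hB hr] at hB'
  rw [psb_iff hC hrC] at hpsb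
  have hcwt := hpsb.cwt hC hrC
  have hrP : IsRoot (B' ∩ C) r' := ⟨hpsb.root_mem, fun x hx => hrC.2 x hx.2⟩
  have hW : IsAlmostFront M (B' ∩ C) (maxIn C ∩ B') := by
    rw [isAlmostFront_iff hcwt hrP]
    refine ⟨fun x hx => hC.subset hx.1.1, fun η hη ν hν hne hle =>
      hη.1.2 ν hν.1.1 (lt_of_le_of_ne hle hne), _, ExSub.refl hrP.1, fun τ hτ => ?_⟩
    have hτ' := hτ.1
    rw [hpsb.maxIn_eq] at hτ'
    exact ⟨τ, ⟨⟨hτ'.1, hτ.2.1⟩, hτ.2⟩, le_rfl⟩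
  have hW' := hfr _ hW
  rw [isAlmostFront_iff hB hr] at hW'
  obtain ⟨-, -, E, hE, hmax⟩ := hW'
  refine ⟨E ∩ B', hE.inter hB', fun e he c hc hle => ?_, fun τ hτ => ?_⟩
  · have h1 := (hpsb.down e ⟨he.1.2, he.2⟩ c hc hle).1
    exact ⟨hE.down e he.1.1 c (hB'.subset h1) hle, h1⟩
  · obtain ⟨w, hw, hle⟩ := hmax τ ⟨hτ.1, hτ.2.1⟩
    exact ⟨w, ⟨hw.1.1, hE.down τ hτ.2.1 w hw.2 hle, hw.1.2⟩, hle⟩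

namespace Dominates

variable {E : Set α}

lemma exists_succ_trace (hC : CWT M C) (hB : CWT M B) (h : Dominates C B E r) {ν τ : α}
    (hν : ν ∈ E ∩ C) (hm : ν ∉ maxIn C) (hτ : τ ∈ maxIn B ∩ E) (hντ : ν ≤ τ) :
    ∃ ϱ ∈ succIn C ν ∩ E, ϱ ≤ τ := by
  have hE := h.exSub
  obtain ⟨μ, hμ, hle⟩ := h.max τ hτ
  have hlt : ν < μ := by
    rcases hB.comparable hτ.1.1 (hE.subset hμ.2) (hE.subset hν.1) hle hντ with h1 | h1
    · rcases h1.eq_or_lt with rfl | h2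
      · exact (hm hμ.1).elim
      · exact (hμ.1.2 ν hν.2 h2).elim
    · exact lt_of_le_of_ne h1 fun h2 => hm (h2 ▸ hμ.1)
  obtain ⟨ϱ, hϱ, hϱμ⟩ := hC.exists_succ_le hμ.1.1 hlt
  exact ⟨ϱ, ⟨hϱ, h.down μ ⟨hμ.2, hμ.1.1⟩ ϱ hϱ.1 hϱμ⟩, hϱμ.trans hle⟩

lemma posSub_trace (hC : CWT M C) (hB : CWT M B) (hrC : IsRoot C r) (hrB : IsRoot B r)
    (h : Dominates C B E r) : PosSub M C (E ∩ C) r := by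
  have hE := h.exSub
  have hP := hE.posSub hB
  refine ⟨inter_subset_right, ⟨hE.root_mem, hrC.1⟩,
    fun ν hν η hη hle => ⟨h.down ν hν η hη hle, hη⟩, fun ν hν hm F hF => ?_⟩
  have hmax : ∀ σ ∈ E, ∃ τ ∈ maxIn B ∩ E, σ ≤ τ := fun σ hσ => by
    rw [← hP.maxIn_eq]
    exact (hP.cwt hB hrB).exists_max_ge hσ
  have hmB : ν ∉ maxIn B := by
    intro hmB
    obtain ⟨ϱ, hϱ, hle⟩ := h.exists_succ_trace hC hB hν hm ⟨hmB, hν.1⟩ le_rfl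
    exact hϱ.1.2.1.not_ge hle
  have key : ∀ σ ∈ succIn B ν ∩ E, ∃ ϱ ∈ succIn C ν ∩ (E ∩ C), σ ≤ ϱ := by
    intro σ hσ
    obtain ⟨τ, hτ, hle⟩ := hmax σ hσ.2
    obtain ⟨ϱ, hϱ, hϱτ⟩ := h.exists_succ_trace hC hB hν hm hτ (hσ.1.2.1.le.trans hle)
    refine ⟨ϱ, ⟨hϱ.1, hϱ.2, hϱ.1.1⟩, ?_⟩
    rcases hB.comparable hτ.1.1 hσ.1.1 (hE.subset hϱ.2) hle hϱτ with h1 | h1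
    · exact h1
    · rcases h1.eq_or_lt with h2 | h2
      · exact h2.ge
      · exact (hσ.1.2.2 ⟨ϱ, hE.subset hϱ.2, hϱ.1.2.1, h2⟩).elim
  choose! f hf hle using key
  refine infinite_of_injOn_mapsTo (f := f) ?_ ?_ (hP.pos ν hν.1 hmB F hF)
  · intro σ hσ σ' hσ' heq
    have h1 := hf σ hσ.1
    have h2 := hle σ hσ.1
    have h3 := hle σ' hσ'.1
    rw [← heq] at h3
    rcases hB.comparable (hE.subset h1.2.1) hσ.1.1.1 hσ'.1.1.1 h2 h3 with h4 | h4
    · exact h4.eq_or_lt.elim id fun h5 => (hσ'.1.1.2.2 ⟨σ, hσ.1.1.1, hσ.1.1.2.1, h5⟩).elim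
    · exact h4.eq_or_lt.elim Eq.symm
        fun h5 => (hσ.1.1.2.2 ⟨σ', hσ'.1.1.1, hσ'.1.1.2.1, h5⟩).elim
  · exact fun σ hσ => ⟨hf σ hσ.1, fun ρ hρ hc => hσ.2 ρ hρ (hc.mono le_rfl (hle σ hσ.1))⟩

lemma isAlmostFront (hC : CWT M C) (hB : CWT M B) (hrC : IsRoot C r) (hrB : IsRoot B r)
    (h : Dominates C B E r) (hY : IsAlmostFront M (E ∩ C) Y) : IsAlmostFront M B Y := by
  have hE := h.exSub
  have hT := h.posSub_trace hC hB hrC hrB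
  have hrT : IsRoot (E ∩ C) r := ⟨hT.root_mem, fun x hx => hrC.2 x hx.2⟩
  rw [isAlmostFront_iff (hT.cwt hC hrC) hrT] at hY
  rw [isAlmostFront_iff hB hrB]
  obtain ⟨h1, h2, D, hD, hmax⟩ := hY
  refine ⟨h1, h2, {σ ∈ E | ∀ c ∈ E ∩ C, c ≤ σ → c ∈ D}, ⟨fun x hx => hE.subset hx.1,
    ⟨hE.root_mem, fun c hc hle => le_antisymm hle (hrC.2 c hc.2) ▸ hD.root_mem⟩,
    fun ν hν η hη hle => ⟨hE.down ν hν.1 η hη hle, fun c hc hcη => hν.2 c hc (hcη.trans hle)⟩,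
    fun ν hν => ?_⟩, fun τ hτ => ?_⟩
  · have hνB := hE.subset hν.1
    obtain ⟨κ, hκ, hκν, hlast⟩ := hB.exists_last_below hνB (fun x hx => hE.subset hx.1)
      hrT.1 (hrB.2 ν hνB)
    refine ((hE.cofin ν hν.1).union (hD.cofin κ (hν.2 κ hκ hκν))).subset ?_
    rintro σ ⟨hσ, hσn⟩
    by_cases hσE : σ ∈ E
    · right
      simp only [mem_ofPred_eq, not_and, not_forall] at hσn
      obtain ⟨c, hc, hcσ, hcD⟩ := hσn hσE
      have hcσ' : c = σ := by
        rcases hcσ.eq_or_lt with h3 | h3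
        · exact h3
        · exact (hcD (hν.2 c hc (hB.le_of_lt_succ hνB hσ (hE.subset hc.1) h3))).elim
      subst hcσ'
      refine ⟨⟨hc, hκν.trans_lt hσ.2.1, ?_⟩, hcD⟩
      rintro ⟨d, hd, h3, h4⟩
      exact (hlast d hd (hB.le_of_lt_succ hνB hσ (hE.subset hd.1) h4)).not_gt h3
    · exact Or.inl ⟨hσ, hσE⟩
  · obtain ⟨μ, hμ, hle⟩ := h.max τ ⟨hτ.1, hτ.2.1⟩
    have hμD := hτ.2.2 μ ⟨hμ.2, hμ.1.1⟩ hle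
    obtain ⟨w, hw, hwμ⟩ := hmax μ ⟨hT.maxIn_eq ▸ ⟨hμ.1, hμ.2, hμ.1.1⟩, hμD⟩
    exact ⟨w, ⟨hw.1, hE.subset hw.2.1⟩, hwμ.trans hle⟩

lemma leStar (hC : CWT M C) (hB : CWT M B) (hrC : IsRoot C r) (hrB : IsRoot B r)
    (h : Dominates C B E r) : leStar M C B :=
  ⟨hC, hB, ⟨r, hrC, hrB⟩, E, (sb_iff hB hrB).2 h.exSub,
    (psb_iff hC hrC).2 (h.posSub_trace hC hB hrC hrB),
    fun _ hY => h.isAlmostFront hC hB hrC hrB hY⟩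

lemma of_posSub (h : Dominates C B E r) (hP : PosSub M B P r) : Dominates C P (E ∩ P) r := by
  refine ⟨h.exSub.inter_posSub hP, fun e he c hc hle => ?_, fun τ hτ => ?_⟩
  · have h1 := h.down e ⟨he.1.1, he.2⟩ c hc hle
    exact ⟨h1, hP.down e he.1.2 c (h.exSub.subset h1) hle⟩
  · rw [hP.maxIn_eq] at hτ
    obtain ⟨μ, hμ, hle⟩ := h.max τ ⟨hτ.1.1, hτ.2.1⟩
    exact ⟨μ, ⟨hμ.1, hμ.2, hP.down τ hτ.2.2 μ (h.exSub.subset hμ.2) hle⟩, hle⟩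

lemma transfer (hC : CWT M C) (hB : CWT M B) (hrC : IsRoot C r) (hrB : IsRoot B r)
    (h : Dominates C B E r) (hY : IsAlmostFront M C Y) : IsAlmostFront M B Y :=
  h.isAlmostFront hC hB hrC hrB (hY.posSub hC hrC (h.posSub_trace hC hB hrC hrB))

end Dominates

lemma leStar.refl (hB : CWT M B) (hr : IsRoot B r) : leStar M B B :=
  Dominates.leStar (E := B) hB hB hr hr
    ⟨ExSub.refl hr.1, fun _ _ _ hc _ => hc, fun τ hτ => ⟨τ, hτ, le_rfl⟩⟩

/-- The node `ν` of `G` forces `Z` one step ahead of `S`: if maximal, it lies above a member of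
`Z`; otherwise positively many of its successors in `G` lie in `S`. -/
def forceStep (M B G Z : Set α) : Set α →o Set α where
  toFun S := {ν ∈ G | (ν ∈ maxIn B ∧ ∃ w ∈ Z ∩ B, w ≤ ν) ∨ (ν ∉ maxIn B ∧
    ∀ F : Finset α, (F : Set α) ⊆ M \ {ρ | ρ ≤ ν} →
      {ϱ ∈ succIn B ν ∩ (G ∩ S) | ∀ ρ ∈ F, ¬Compat M ρ ϱ}.Infinite)}
  monotone' S S' h := by
    rintro ν ⟨h1, h2⟩
    refine ⟨h1, h2.imp_right fun h3 => ⟨h3.1, fun F hF => (h3.2 F hF).mono ?_⟩⟩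
    rintro ϱ ⟨⟨h4, h5, h6⟩, h7⟩
    exact ⟨⟨h4, h5, h h6⟩, h7⟩

lemma posSub_hereditary (hB : CWT M B) (hr : IsRoot B r) {G S : Set α} (hG : ExSub B G r)
    (hrS : r ∈ S) (hS : ∀ ν ∈ G ∩ S, ν ∉ maxIn B → ∀ F : Finset α, (F : Set α) ⊆ M \ {ρ | ρ ≤ ν} →
      {ϱ ∈ succIn B ν ∩ (G ∩ S) | ∀ ρ ∈ F, ¬Compat M ρ ϱ}.Infinite) :
    PosSub M B {σ ∈ G | ∀ η ∈ B, η ≤ σ → η ∈ S} r := by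
  refine ⟨fun x hx => hG.subset hx.1,
    ⟨hG.root_mem, fun η hη hle => le_antisymm hle (hr.2 η hη) ▸ hrS⟩,
    fun ν hν η hη hle => ⟨hG.down ν hν.1 η hη hle, fun c hc hcη => hν.2 c hc (hcη.trans hle)⟩,
    fun ν hν hm F hF => ?_⟩
  have hνB := hG.subset hν.1
  refine (hS ν ⟨hν.1, hν.2 ν hνB le_rfl⟩ hm F hF).mono ?_
  rintro ϱ ⟨⟨h1, h2, h3⟩, h4⟩
  refine ⟨⟨h1, h2, fun c hc hle => ?_⟩, h4⟩
  rcases hle.eq_or_lt with rfl | hlt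
  · exact h3
  · exact hν.2 c hc (hB.le_of_lt_succ hνB h1 hc hlt)

lemma exists_posSub_deciding (hB : CWT M B) (hr : IsRoot B r) (hY : IsAlmostFront M B Y)
    (Z : Set α) : ∃ P, PosSub M B P r ∧
      ((∀ τ ∈ maxIn B ∩ P, ∃ w ∈ Z ∩ B, w ≤ τ) ∨ ∀ τ ∈ maxIn B ∩ P, ∃ w ∈ (Y \ Z) ∩ B, w ≤ τ) := by
  classical
  rw [isAlmostFront_iff hB hr] at hY
  obtain ⟨-, -, G, hG, hmax⟩ := hY
  set S := (forceStep M B G Z).lfp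
  have hfix : forceStep M B G Z S = S := (forceStep M B G Z).map_lfp
  have hmem : ∀ ν, ν ∈ S ↔ ν ∈ forceStep M B G Z S := fun ν => by rw [hfix]
  by_cases hrS : r ∈ S
  · refine ⟨_, posSub_hereditary hB hr hG hrS fun ν hν hm => ?_, Or.inl fun τ hτ => ?_⟩
    · rcases ((hmem ν).1 hν.2).2 with h | h
      · exact (hm h.1).elim
      · exact h.2
    · rcases ((hmem τ).1 (hτ.2.2 τ hτ.1.1 le_rfl)).2 with h | h
      · exact h.2
      · exact (h.1 hτ.1).elim
  · refine ⟨_, posSub_hereditary hB hr (S := Sᶜ) hG hrS fun ν hν hm F hF => ?_,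
      Or.inr fun τ hτ => ?_⟩
    · have h1 : ν ∉ forceStep M B G Z S := fun h => hν.2 ((hmem ν).2 h)
      have h2 : ∃ F₀ : Finset α, (F₀ : Set α) ⊆ M \ {ρ | ρ ≤ ν} ∧
          {ϱ ∈ succIn B ν ∩ (G ∩ S) | ∀ ρ ∈ F₀, ¬Compat M ρ ϱ}.Finite := by
        by_contra! h3
        exact h1 ⟨hν.1, Or.inr ⟨hm, h3⟩⟩
      obtain ⟨F₀, hF₀, hfin⟩ := h2
      refine (((hG.posSub hB).pos ν hν.1 hm (F ∪ F₀) ?_).sdiff hfin).mono ?_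
      · rw [Finset.coe_union]
        exact union_subset hF hF₀
      · rintro ϱ ⟨⟨h3, h4⟩, h5⟩
        refine ⟨⟨h3.1, h3.2, fun h6 => h5 ⟨⟨h3.1, h3.2, h6⟩, fun ρ hρ => ?_⟩⟩, fun ρ hρ => ?_⟩
        · exact h4 ρ (Finset.mem_union_right _ hρ)
        · exact h4 ρ (Finset.mem_union_left _ hρ)
    · obtain ⟨w, hw, hle⟩ := hmax τ ⟨hτ.1, hτ.2.1⟩
      refine ⟨w, ⟨⟨hw.1, fun hZ => ?_⟩, hw.2⟩, hle⟩
      exact hτ.2.2 τ hτ.1.1 le_rfl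
        ((hmem τ).2 ⟨hτ.2.1, Or.inl ⟨hτ.1, w, ⟨hZ, hw.2⟩, hle⟩⟩)

lemma inter_subset_of_max (hB : CWT M B) (hr : IsRoot B r) (hP : PosSub M B P r)
    (hanti : ∀ η ∈ Y, ∀ ν ∈ Y, η ≠ ν → ¬η ≤ ν) (hZ : Z ⊆ Y)
    (h : ∀ τ ∈ maxIn B ∩ P, ∃ w ∈ Z ∩ B, w ≤ τ) : P ∩ Y ⊆ Z := by
  rintro y ⟨hyP, hyY⟩
  obtain ⟨τ, hτ, hle⟩ := (hP.cwt hB hr).exists_max_ge hyP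
  rw [hP.maxIn_eq] at hτ
  obtain ⟨w, hw, hwτ⟩ := h τ hτ
  by_contra hyZ
  have hne : y ≠ w := fun h' => hyZ (h' ▸ hw.1)
  rcases hB.comparable hτ.1.1 (hP.subset hyP) hw.2 hle hwτ with h1 | h1
  · exact hanti y hyY w (hZ hw.1) hne h1
  · exact hanti w (hZ hw.1) y hyY hne.symm h1

/-- The tree with root `r` whose immediate subtrees are the `U i`. -/
def glue {β : Type*} (r : β) (U : ℕ → Set β) : Set β :=
  insert r (⋃ i, U i)

/-- Conditions on the trees `U i`, with roots `η i`, under which `glue r U` is a tree. -/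
structure Gluable (M : Set α) (r : α) (U : ℕ → Set α) (η : ℕ → α) : Prop where
  root_mem : r ∈ M
  cwt : ∀ i, CWT M (U i)
  isRoot : ∀ i, IsRoot (U i) (η i)
  lt : ∀ i, r < η i
  incompat : ∀ i j, i ≠ j → ¬Compat M (η i) (η j)
  pos : ∀ F : Finset α, (F : Set α) ⊆ M \ {ρ | ρ ≤ r} →
    {i | ∀ ρ ∈ F, ¬Compat M ρ (η i)}.Infinite

namespace Gluable

lemma mem_glue {β : Type*} {r σ : β} {U : ℕ → Set β} {i : ℕ} (hσ : σ ∈ U i) : σ ∈ glue r U :=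
  Or.inr (mem_iUnion.2 ⟨i, hσ⟩)

lemma eq_or_mem {β : Type*} {r σ : β} {U : ℕ → Set β} (hσ : σ ∈ glue r U) :
    σ = r ∨ ∃ i, σ ∈ U i :=
  hσ.imp_right mem_iUnion.1

variable {U : ℕ → Set α} {η : ℕ → α} {i j : ℕ} {σ σ' : α}

lemma root_lt (h : Gluable M r U η) (hσ : σ ∈ U i) : r < σ :=
  (h.lt i).trans_le ((h.isRoot i).2 σ hσ)

lemma isRoot_glue (h : Gluable M r U η) : IsRoot (glue r U) r := by
  refine ⟨Or.inl rfl, fun σ hσ => ?_⟩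
  rcases eq_or_mem hσ with rfl | ⟨i, hi⟩
  · exact le_rfl
  · exact (h.root_lt hi).le

lemma index_eq (h : Gluable M r U η) (hσ : σ ∈ U i) (hσ' : σ' ∈ U j) (hc : Compat M σ σ') :
    i = j := by
  by_contra hne
  exact h.incompat i j hne (hc.mono ((h.isRoot i).2 σ hσ) ((h.isRoot j).2 σ' hσ'))

lemma mem_of_le (h : Gluable M r U η) (hσ : σ ∈ U i) (hσ' : σ' ∈ glue r U) (hle : σ ≤ σ') :
    σ' ∈ U i := by
  rcases eq_or_mem hσ' with rfl | ⟨j, hj⟩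
  · exact ((h.root_lt hσ).not_ge hle).elim
  · obtain rfl := h.index_eq hσ hj ⟨σ', (h.cwt j).subset hj, hle, le_rfl⟩
    exact hj

lemma eq_or_mem_of_le (h : Gluable M r U η) (hσ : σ ∈ U i) (hσ' : σ' ∈ glue r U) (hle : σ' ≤ σ) :
    σ' = r ∨ σ' ∈ U i := by
  refine (eq_or_mem hσ').imp_right fun ⟨j, hj⟩ => ?_
  obtain rfl := h.index_eq hj hσ ⟨σ, (h.cwt i).subset hσ, hle, le_rfl⟩
  exact hj

lemma succIn_root (h : Gluable M r U η) : succIn (glue r U) r = range η := by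
  ext σ
  constructor
  · rintro ⟨h1, h2, h3⟩
    rcases eq_or_mem h1 with rfl | ⟨i, hi⟩
    · exact h2.false.elim
    · rcases ((h.isRoot i).2 σ hi).eq_or_lt with h4 | h4
      · exact ⟨i, h4⟩
      · exact (h3 ⟨η i, mem_glue (h.isRoot i).1, h.lt i, h4⟩).elim
  · rintro ⟨i, rfl⟩
    refine ⟨mem_glue (h.isRoot i).1, h.lt i, ?_⟩
    rintro ⟨τ, hτ, h1, h2⟩
    rcases h.eq_or_mem_of_le (h.isRoot i).1 hτ h2.le with rfl | h3
    · exact h1.false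
    · exact h2.not_ge ((h.isRoot i).2 τ h3)

lemma succIn_of_mem (h : Gluable M r U η) (hσ : σ ∈ U i) :
    succIn (glue r U) σ = succIn (U i) σ := by
  ext τ
  constructor
  · rintro ⟨h1, h2, h3⟩
    exact ⟨h.mem_of_le hσ h1 h2.le, h2, fun ⟨ρ, r1, r2⟩ => h3 ⟨ρ, mem_glue r1, r2⟩⟩
  · rintro ⟨h1, h2, h3⟩
    exact ⟨mem_glue h1, h2, fun ⟨ρ, r1, r2⟩ => h3 ⟨ρ, h.mem_of_le hσ r1 r2.1.le, r2⟩⟩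

lemma mem_maxIn (h : Gluable M r U η) (hσ : σ ∈ U i) : σ ∈ maxIn (glue r U) ↔ σ ∈ maxIn (U i) :=
  ⟨fun h1 => ⟨hσ, fun _ hν => h1.2 _ (mem_glue hν)⟩,
    fun h1 => ⟨mem_glue hσ, fun ν hν hlt => h1.2 ν (h.mem_of_le hσ hν hlt.le) hlt⟩⟩

lemma injective (h : Gluable M r U η) : Function.Injective η := fun i j hij => by
  by_contra hne
  exact h.incompat i j hne ⟨η j, (h.cwt j).subset (h.isRoot j).1, hij.le, le_rfl⟩

lemma cwt_glue (h : Gluable M r U η) : CWT M (glue r U) := by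
  refine ⟨?_, (countable_iUnion fun i => (h.cwt i).2.1).insert r, ⟨r, h.isRoot_glue⟩,
    fun ν hν a ha b hb hle hle' => ?_, fun S hS hc => ?_, fun ν hν => ?_,
    fun a ha b hb hab hba hcomp => ?_, fun ν hν F hF => ?_⟩
  · exact insert_subset h.root_mem (iUnion_subset fun i => (h.cwt i).subset)
  · rcases eq_or_mem hν with rfl | ⟨i, hi⟩
    · exact Or.inl (hle.trans (h.isRoot_glue.2 b hb))
    · rcases h.eq_or_mem_of_le hi ha hle with rfl | ha'
      · exact Or.inl (h.isRoot_glue.2 b hb)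
      rcases h.eq_or_mem_of_le hi hb hle' with rfl | hb'
      · exact Or.inr (h.isRoot_glue.2 a ha)
      exact (h.cwt i).comparable hi ha' hb' hle hle'
  · by_cases hne : ∃ i, ∃ σ ∈ S, σ ∈ U i
    · obtain ⟨i, σ, hσ, hi⟩ := hne
      refine (((h.cwt i).chain_finite (S := S ∩ U i) inter_subset_right
        (hc.mono inter_subset_left)).insert r).subset fun τ hτ => ?_
      rcases hc.total hσ hτ with h1 | h1
      · exact Or.inr ⟨hτ, h.mem_of_le hi (hS hτ) h1⟩
      · exact (h.eq_or_mem_of_le hi (hS hτ) h1).imp_right fun h2 => ⟨hτ, h2⟩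
    · push Not at hne
      refine (finite_singleton r).subset fun τ hτ => ?_
      rcases eq_or_mem (hS hτ) with h1 | ⟨i, hi⟩
      · exact h1
      · exact (hne i τ hτ hi).elim
  · rcases eq_or_mem hν with rfl | ⟨i, hi⟩
    · right
      rw [h.succIn_root]
      exact infinite_range_of_injective h.injective
    · rw [h.succIn_of_mem hi]
      exact (h.cwt i).2.2.2.2.2.1 ν hi
  · rcases eq_or_mem ha with rfl | ⟨i, hi⟩
    · exact hab (h.isRoot_glue.2 b hb)
    rcases eq_or_mem hb with rfl | ⟨j, hj⟩
    · exact hba (h.isRoot_glue.2 a (mem_glue hi))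
    obtain rfl := h.index_eq hi hj hcomp
    exact (h.cwt i).2.2.2.2.2.2.1 a hi b hj hab hba hcomp
  · rcases eq_or_mem hν.1 with rfl | ⟨i, hi⟩
    · rw [h.succIn_root]
      refine ((h.pos F hF).image h.injective.injOn).mono ?_
      rintro _ ⟨i, hi, rfl⟩
      exact ⟨⟨i, rfl⟩, hi⟩
    · rw [h.succIn_of_mem hi]
      exact (h.cwt i).succ_infinite hi (fun hm => hν.2 ((h.mem_maxIn hi).2 hm)) hF

lemma dominates_glue (h : Gluable M r U η) {T : ℕ → Set α}
    (hT : ∀ i, CWT M (T i)) (hrT : ∀ i, IsRoot (T i) r) (hη : ∀ i, η i ∈ succIn (T i) r)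
    (hU : ∀ i, U i = T i ∩ {ρ | η i ≤ ρ}) (k : ℕ) {E : ℕ → Set α}
    (hE : ∀ i, k ≤ i → Dominates C (T i) (E i) r ∧ η i ∈ E i) :
    Dominates C (glue r U) {σ | σ = r ∨ ∃ i, k ≤ i ∧ σ ∈ E i ∩ U i} r := by
  have hroot : ∀ i, k ≤ i → ∀ c ∈ E i, ∀ e ∈ U i, c ≤ e → c = r ∨ c ∈ U i := by
    intro i hi c hc e he hle
    have hcT := (hE i hi).1.exSub.subset hc
    have heT : e ∈ T i ∩ {ρ | η i ≤ ρ} := hU i ▸ he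
    rcases (hT i).comparable heT.1 hcT (hη i).1 hle heT.2 with h1 | h1
    · rcases h1.eq_or_lt with rfl | h2
      · exact Or.inr (h.isRoot i).1
      · exact Or.inl (le_antisymm ((hT i).le_of_lt_succ (hrT i).1 (hη i) hcT h2)
          ((hrT i).2 c hcT))
    · rw [hU i]
      exact Or.inr ⟨hcT, h1⟩
  refine ⟨⟨?_, Or.inl rfl, ?_, ?_⟩, ?_, ?_⟩
  · rintro σ (rfl | ⟨i, -, hi⟩)
    · exact h.isRoot_glue.1
    · exact mem_glue hi.2
  · rintro ν (rfl | ⟨i, hk, hi⟩) c hc hle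
    · exact Or.inl (le_antisymm hle (h.isRoot_glue.2 c hc))
    · refine (h.eq_or_mem_of_le hi.2 hc hle).imp_right fun hci => ⟨i, hk, ?_, hci⟩
      have hcT : c ∈ T i ∩ {ρ | η i ≤ ρ} := hU i ▸ hci
      exact (hE i hk).1.exSub.down ν hi.1 c hcT.1 hle
  · rintro ν (rfl | ⟨i, hk, hi⟩)
    · rw [h.succIn_root]
      refine ((finite_lt_nat k).image η).subset ?_
      rintro _ ⟨⟨i, rfl⟩, hi⟩
      refine ⟨i, ?_, rfl⟩
      by_contra hk
      exact hi (Or.inr ⟨i, not_lt.1 hk, (hE i (not_lt.1 hk)).2, (h.isRoot i).1⟩)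
    · rw [h.succIn_of_mem hi.2]
      refine ((hE i hk).1.exSub.cofin ν hi.1).subset ?_
      rintro σ ⟨hσ, hσn⟩
      have hνT : ν ∈ T i ∩ {ρ | η i ≤ ρ} := hU i ▸ hi.2
      have hσT : σ ∈ T i ∩ {ρ | η i ≤ ρ} := hU i ▸ hσ.1
      refine ⟨⟨hσT.1, hσ.2.1, fun ⟨τ, t1, t2, t3⟩ => hσ.2.2 ⟨τ, ?_, t2, t3⟩⟩,
        fun h1 => hσn (Or.inr ⟨i, hk, h1, hσ.1⟩)⟩
      rw [hU i]
      exact ⟨t1, hνT.2.trans t2.le⟩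
  · rintro e ⟨rfl | ⟨i, hk, hi⟩, heC⟩ c hc hle
    · have h1 := (hE k le_rfl).1
      have h2 := h1.down e ⟨h1.exSub.root_mem, heC⟩ c hc hle
      exact Or.inl (le_antisymm hle ((hrT k).2 c (h1.exSub.subset h2)))
    · have h1 := (hE i hk).1.down e ⟨hi.1, heC⟩ c hc hle
      exact (hroot i hk c h1 e hi.2 hle).imp_right fun h2 => ⟨i, hk, h1, h2⟩
  · rintro τ ⟨hτ, rfl | ⟨i, hk, hi⟩⟩
    · exact (hτ.2 (η 0) (mem_glue (h.isRoot 0).1) (h.lt 0)).elim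
    · have hτU := (h.mem_maxIn hi.2).1 hτ
      have hτT : τ ∈ T i ∩ {ρ | η i ≤ ρ} := hU i ▸ hi.2
      have hτT' : τ ∈ maxIn (T i) := by
        refine ⟨hτT.1, fun σ hσ hlt => hτU.2 σ ?_ hlt⟩
        rw [hU i]
        exact ⟨hσ, hτT.2.trans hlt.le⟩
      obtain ⟨μ, hμ, hle⟩ := (hE i hk).1.max τ ⟨hτT', hi.1⟩
      exact ⟨μ, ⟨hμ.1, (hroot i hk μ hμ.2 τ hi.2 hle).imp_right fun h2 => ⟨i, hk, hμ.2, h2⟩⟩, hle⟩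

end Gluable

/-- Countably many trees that are boundedly dominated by trees of the family `T` have a common
upper bound. -/
lemma exists_dominates_all (hM : M.Countable) {C T : ℕ → Set α} (hr : r ∈ M)
    (hr_le : ∀ a ∈ M, r ≤ a) (hT : ∀ n, CWT M (T n)) (hrT : ∀ n, IsRoot (T n) r)
    (hne : ∀ n, r ∉ maxIn (T n)) (hdom : ∀ n, ∀ k ≤ n, ∃ E, Dominates (C k) (T n) E r) :
    ∃ B, CWT M B ∧ IsRoot B r ∧ r ∉ maxIn B ∧ ∀ k, ∃ E, Dominates (C k) B E r := by
  classical
  obtain ⟨m, hm⟩ := hM.exists_eq_range ⟨r, hr⟩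
  choose! E hE using hdom
  have hseq : ∀ s : Finset (ℕ × α), (∀ p ∈ s, p.2 ∈ M ∧ r < p.2) →
      ∃ q : ℕ × α, (q.2 ∈ M ∧ r < q.2 ∧ q.2 ∈ succIn (T q.1) r ∧ (∀ k ≤ q.1, q.2 ∈ E q.1 k) ∧
        ∀ k ≤ q.1, r < m k → ¬Compat M (m k) q.2) ∧
        ∀ p ∈ s, p.1 < q.1 ∧ ¬Compat M p.2 q.2 := by
    intro s hs
    set n := s.sup Prod.fst + 1
    set F : Finset α := s.image Prod.snd ∪
      ((Finset.range (n + 1)).image m).filter fun a => r < a with hF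
    have hFM : (F : Set α) ⊆ M \ {ρ | ρ ≤ r} := by
      intro a ha
      simp only [hF, Finset.coe_union, Finset.coe_image, Finset.coe_filter] at ha
      rcases ha with ⟨p, hp, rfl⟩ | ⟨ha, hra⟩
      · exact ⟨(hs p hp).1, (hs p hp).2.not_ge⟩
      · obtain ⟨k, -, rfl⟩ := Finset.mem_image.1 ha
        exact ⟨hm ▸ mem_range_self k, hra.not_ge⟩
    have hfin : (⋃ k ∈ Iic n, succIn (T n) r \ E n k).Finite :=
      (finite_Iic n).biUnion fun k hk => (hE n k hk).exSub.cofin r (hE n k hk).exSub.root_mem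
    obtain ⟨η, ⟨hη, hηF⟩, hηE⟩ :=
      (((hT n).succ_infinite (hrT n).1 (hne n) hFM).sdiff hfin).nonempty
    refine ⟨(n, η), ⟨(hT n).subset hη.1, hη.2.1, hη, fun k hk => ?_, fun k hk hrk => ?_⟩,
      fun p hp => ⟨Nat.lt_succ_of_le (Finset.le_sup (f := Prod.fst) hp), ?_⟩⟩
    · by_contra h
      exact hηE (mem_biUnion (show k ∈ Iic n from hk) ⟨hη, h⟩)
    · refine hηF _ (Finset.mem_union_right _ (Finset.mem_filter.2 ⟨?_, hrk⟩))
      exact Finset.mem_image_of_mem _ (Finset.mem_range.2 (Nat.lt_succ_of_le hk))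
    · exact hηF _ (Finset.mem_union_left _ (Finset.mem_image_of_mem _ hp))
  obtain ⟨f, hf, hlt⟩ := exists_seq_of_forall_finset_exists
    (fun q : ℕ × α => q.2 ∈ M ∧ r < q.2 ∧ q.2 ∈ succIn (T q.1) r ∧ (∀ k ≤ q.1, q.2 ∈ E q.1 k) ∧
        ∀ k ≤ q.1, r < m k → ¬Compat M (m k) q.2)
    (fun p q => p.1 < q.1 ∧ ¬Compat M p.2 q.2)
    (fun s hs => hseq s fun p hp => ⟨(hs p hp).1, (hs p hp).2.1⟩)
  have hmono : StrictMono fun i => (f i).1 := fun i j hij => (hlt i j hij).1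
  have hle : ∀ i, i ≤ (f i).1 := fun i => hmono.le_apply
  have hG : Gluable M r (fun i => T (f i).1 ∩ {ρ | (f i).2 ≤ ρ}) fun i => (f i).2 := by
    refine ⟨hr, fun i => (hT _).cone (hf i).2.2.1.1, fun i => ⟨⟨(hf i).2.2.1.1, le_refl (f i).2⟩,
      fun x hx => hx.2⟩, fun i => (hf i).2.1, fun i j hij => ?_, fun F hF => ?_⟩
    · rcases hij.lt_or_gt with h1 | h1
      · exact (hlt i j h1).2
      · exact fun h2 => (hlt j i h1).2 h2.symm
    · have hk : ∀ ρ ∈ F, ∃ k, m k = ρ := fun ρ hρ => by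
        have := (hF hρ).1
        rwa [hm] at this
      choose! g hg using hk
      refine (Ici_infinite (F.sup g)).mono fun i hi ρ hρ => ?_
      have h1 : g ρ ≤ (f i).1 := (Finset.le_sup hρ).trans (le_trans hi (hle i))
      have h2 := (hf i).2.2.2.2 (g ρ) h1
      rw [hg ρ hρ] at h2
      exact h2 (lt_of_le_not_ge (hr_le ρ (hF hρ).1) (hF hρ).2)
  exact ⟨_, hG.cwt_glue, hG.isRoot_glue,
    fun h => h.2 (f 0).2 (Gluable.mem_glue (hG.isRoot 0).1) (hG.lt 0),
    fun k => ⟨_, hG.dominates_glue (E := fun i => E (f i).1 k) (fun i => hT (f i).1)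
      (fun i => hrT _) (fun i => (hf i).2.2.1) (fun _ => rfl) k
      fun i hi => ⟨hE (f i).1 k (hi.trans (hle i)), (hf i).2.2.2.1 k (hi.trans (hle i))⟩⟩⟩

end Trees

namespace KSys

variable [PartialOrder α] (x : KSys α)

lemma norm_le_aleph0_iff :
    x.norm ≤ Cardinal.aleph0 ↔ x.M.Countable ∧ ∀ η ∈ x.M, (x.A η).Countable := by
  rw [KSys.norm, ← Cardinal.mk_sigma]
  constructor
  · intro h
    have h1 := (Cardinal.mk_le_aleph0_iff.1 (le_self_add.trans h))
    have h2 := (Cardinal.mk_le_aleph0_iff.1 (le_add_self.trans h))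
    exact ⟨h1, fun η hη => (sigma_mk_injective (β := fun η : x.M => x.A η)
      (i := ⟨η, hη⟩)).countable⟩
  · rintro ⟨h1, h2⟩
    have : Countable x.M := h1
    have : ∀ η : x.M, Countable (x.A η) := fun η => h2 η η.2
    exact Cardinal.add_le_aleph0.2 ⟨Cardinal.mk_le_aleph0, Cardinal.mk_le_aleph0⟩

lemma root_notMem_maxIn {B : Set α} (hB : B ∈ x.Bf) : x.rt ∉ maxIn B := by
  intro hm
  have hr := x.A_root _ x.rt_mem B hB.1
  refine hB.2 (Subset.antisymm (fun b hb => ?_) (singleton_subset_iff.2 hr.1))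
  by_contra hne
  exact hm.2 b hb (lt_of_le_of_ne (hr.2 b hb) (Ne.symm hne))

lemma exists_lex_all {C : ℕ → Set α} (hC : ∀ n, C n ∈ x.Bf) (n : ℕ) :
    ∃ T ∈ x.Bf, ∀ k ≤ n, x.lex (C k) T := by
  induction n with
  | zero => exact ⟨C 0, hC 0, fun k hk => by
    obtain rfl := Nat.le_zero.1 hk
    exact x.lex_refl _ (hC 0)⟩
  | succ n ih =>
    obtain ⟨T, hT, h⟩ := ih
    obtain ⟨T', hT', h1, h2⟩ := x.lex_directed T hT (C (n + 1)) (hC _)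
    refine ⟨T', hT', fun k hk => ?_⟩
    rcases Nat.le_succ_iff.1 hk with h3 | rfl
    · exact x.lex_trans _ _ _ (h k h3) h1
    · exact h2

/-- Add to `x` a new largest member `P` of `ℬ_x`, together with all its cones. -/
def adjoin (P : Set α) (hP : CWT x.M P) (hr : IsRoot P x.rt) (hPx : P ∉ x.Bf)
    (hne : P ≠ {x.rt}) (hle : ∀ B ∈ x.Bf, leStar x.M B P) : KSys α where
  M := x.M
  rt := x.rt
  rt_mem := x.rt_mem
  rt_least := x.rt_least
  A η := x.A η ∪ {S | η ∈ P ∧ S = P ∩ {ρ | η ≤ ρ}}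
  A_empty η hη := by
    rw [x.A_empty η hη, empty_union, eq_empty_iff_forall_notMem]
    exact fun S hS => hη (hP.subset hS.1)
  A_cwt := by
    rintro η hη B (hB | ⟨hη', rfl⟩)
    · exact x.A_cwt η hη B hB
    · exact hP.cone hη'
  A_root := by
    rintro η hη B (hB | ⟨hη', rfl⟩)
    · exact x.A_root η hη B hB
    · exact ⟨⟨hη', le_refl η⟩, fun _ hx => hx.2⟩
  A_singleton η hη := Or.inl (x.A_singleton η hη)
  lex B₁ B₂ := x.lex B₁ B₂ ∨ B₂ = P ∧ (B₁ ∈ x.Bf ∨ B₁ = P)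
  lex_mem := by
    have hPmem : P ∈ (x.A x.rt ∪ {S | x.rt ∈ P ∧ S = P ∩ {ρ | x.rt ≤ ρ}}) \ {{x.rt}} :=
      ⟨Or.inr ⟨hr.1, hr.inter_eq.symm⟩, hne⟩
    rintro B₁ B₂ (h | ⟨rfl, h | rfl⟩)
    · obtain ⟨h1, h2⟩ := x.lex_mem _ _ h
      exact ⟨⟨Or.inl h1.1, h1.2⟩, ⟨Or.inl h2.1, h2.2⟩⟩
    · exact ⟨⟨Or.inl h.1, h.2⟩, hPmem⟩
    · exact ⟨hPmem, hPmem⟩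
  lex_refl := by
    rintro B ⟨hB | ⟨-, rfl⟩, hB'⟩
    · exact Or.inl (x.lex_refl B ⟨hB, hB'⟩)
    · rw [hr.inter_eq]
      exact Or.inr ⟨rfl, Or.inr rfl⟩
  lex_trans := by
    rintro B₁ B₂ B₃ (h | ⟨rfl, h⟩) (h' | ⟨rfl, h'⟩)
    · exact Or.inl (x.lex_trans _ _ _ h h')
    · exact Or.inr ⟨rfl, Or.inl (x.lex_mem _ _ h).1⟩
    · exact (hPx (x.lex_mem _ _ h').1).elim
    · exact Or.inr ⟨rfl, h⟩
  lex_antisymm := by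
    rintro B₁ B₂ (h | ⟨rfl, h⟩) (h' | ⟨rfl, h'⟩)
    · exact x.lex_antisymm _ _ h h'
    · exact (hPx (x.lex_mem _ _ h).1).elim
    · exact (hPx (x.lex_mem _ _ h').1).elim
    · rfl
  lex_directed := by
    have hmem : ∀ B ∈ (x.A x.rt ∪ {S | x.rt ∈ P ∧ S = P ∩ {ρ | x.rt ≤ ρ}}) \ {{x.rt}},
        B ∈ x.Bf ∨ B = P := by
      rintro B ⟨hB | ⟨-, rfl⟩, hB'⟩
      · exact Or.inl ⟨hB, hB'⟩
      · exact Or.inr hr.inter_eq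
    intro B₁ h₁ B₂ h₂
    exact ⟨P, ⟨Or.inr ⟨hr.1, hr.inter_eq.symm⟩, hne⟩,
      Or.inr ⟨rfl, hmem B₁ h₁⟩, Or.inr ⟨rfl, hmem B₂ h₂⟩⟩
  lex_leStar := by
    rintro B₁ B₂ (h | ⟨rfl, h | rfl⟩)
    · exact x.lex_leStar _ _ h
    · exact hle _ h
    · exact leStar.refl hP hr
  A_restrict := by
    rintro η hη B (hB | ⟨hη', rfl⟩) ν hν
    · exact Or.inl (x.A_restrict η hη B hB ν hν)
    · refine Or.inr ⟨hν.1, ?_⟩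
      ext ρ
      exact ⟨fun h => ⟨h.1.1, h.2⟩, fun h => ⟨⟨h.1, le_trans hν.2 h.2⟩, h.2⟩⟩

variable {x}

lemma mem_D {P Y Z : Set α} (hPx : P ∈ x.Bf) (hZ : Z ⊆ Y) (hY : IsAlmostFront x.M P Y)
    (h : P ∩ Y ⊆ Z) : Z ∈ x.D Y := by
  have hP := x.A_cwt _ x.rt_mem P hPx.1
  have hr := x.A_root _ x.rt_mem P hPx.1
  exact ⟨hZ, P, hPx, P, (sb_iff hP hr).2 (ExSub.refl hr.1), hY, h⟩

/-- Every tree dominating `ℬ_x` lies in `ℬ_y` for some countable extension `y` of `x`. -/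
lemma exists_extension_mem (hx : x.norm ≤ Cardinal.aleph0) {P : Set α} (hP : CWT x.M P)
    (hr : IsRoot P x.rt) (hne : P ≠ {x.rt}) (hle : ∀ B ∈ x.Bf, leStar x.M B P) :
    ∃ y : KSys α, y.norm ≤ Cardinal.aleph0 ∧ KLE x y ∧ y.M = x.M ∧ P ∈ y.Bf := by
  by_cases hPx : P ∈ x.Bf
  · exact ⟨x, hx, ⟨Subset.rfl, fun _ _ _ _ => Iff.rfl, fun _ _ => Subset.rfl, rfl,
      fun _ _ _ _ => Iff.rfl⟩, rfl, hPx⟩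
  · refine ⟨x.adjoin P hP hr hPx hne hle, ?_, ⟨Subset.rfl, fun _ _ _ _ => Iff.rfl,
      fun _ _ => subset_union_left, rfl, fun B₁ _ B₂ h₂ => ⟨Or.inl, ?_⟩⟩, rfl,
      Or.inr ⟨hr.1, hr.inter_eq.symm⟩, hne⟩
    · rw [norm_le_aleph0_iff] at hx ⊢
      refine ⟨hx.1, fun η hη => (hx.2 η hη).union ?_⟩
      exact (countable_singleton (P ∩ {ρ | η ≤ ρ})).mono fun S hS => hS.2
    · rintro (h | ⟨rfl, -⟩)
      · exact h
      · exact (hPx h₂).elim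

end KSys

/-- if `x ∈ 𝐊_{≤ℵ₀}`, `Y` is an almost front of some member of `ℬ_x` and
`Z ⊆ Y`, then some `y ∈ 𝐊_{≤ℵ₀}` with `x ≤_𝐊 y` decides `Z`: `Z ∈ D^y_Y` or
`Y \ Z ∈ D^y_Y`. -/
theorem exists_extension_deciding [PartialOrder α] (x : KSys α)
    (hx : x.norm ≤ Cardinal.aleph0) (B Y : Set α) (hB : B ∈ x.Bf)
    (hY : IsAlmostFront x.M B Y) (Z : Set α) (hZ : Z ⊆ Y) :
    ∃ y : KSys α, y.norm ≤ Cardinal.aleph0 ∧ KLE x y ∧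
      (Z ∈ y.D Y ∨ Y \ Z ∈ y.D Y) := by
  have hcount := x.norm_le_aleph0_iff.1 hx
  obtain ⟨C, hC⟩ : ∃ C : ℕ → Set α, x.Bf = range C :=
    ((hcount.2 _ x.rt_mem).mono sdiff_subset).exists_eq_range ⟨B, hB⟩
  have hCmem : ∀ n, C n ∈ x.Bf := fun n => hC ▸ mem_range_self n
  have hcwt : ∀ {D}, D ∈ x.Bf → CWT x.M D := fun h => x.A_cwt _ x.rt_mem _ h.1
  have hroot : ∀ {D}, D ∈ x.Bf → IsRoot D x.rt := fun h => x.A_root _ x.rt_mem _ h.1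
  choose T hT hCT using x.exists_lex_all hCmem
  obtain ⟨T', hT', hrT', hmax, hdom⟩ := exists_dominates_all hcount.1 x.rt_mem x.rt_least
    (fun n => hcwt (hT n)) (fun n => hroot (hT n)) (fun n => x.root_notMem_maxIn (hT n))
    fun n k hk => (x.lex_leStar _ _ (hCT n k hk)).exists_dominates (hroot (hT n))
  obtain ⟨j, rfl⟩ : ∃ j, C j = B := by rwa [hC] at hB
  have hYT : IsAlmostFront x.M T' Y := by
    obtain ⟨E, hE⟩ := hdom j
    exact hE.transfer (hcwt hB) hT' (hroot hB) hrT' hY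
  obtain ⟨P, hP, hdec⟩ := exists_posSub_deciding hT' hrT' hYT Z
  have hPc := hP.cwt hT' hrT'
  have hrP : IsRoot P x.rt := ⟨hP.root_mem, fun a ha => hrT'.2 a (hP.subset ha)⟩
  have hne : P ≠ {x.rt} := by
    rintro rfl
    obtain ⟨σ, hσ⟩ := (hP.succ_infinite hrP.1 hmax).nonempty
    exact hσ.2.1.ne' hσ.1
  obtain ⟨y, hy, hxy, hM, hPy⟩ := KSys.exists_extension_mem hx hPc hrP hne (by
    rw [hC]
    rintro _ ⟨k, rfl⟩
    obtain ⟨E, hE⟩ := hdom k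
    exact (hE.of_posSub hP).leStar (hcwt (hCmem k)) hPc (hroot (hCmem k)) hrP)
  have hYP : IsAlmostFront y.M P Y := hM ▸ hYT.posSub hT' hrT' hP
  refine ⟨y, hy, hxy, hdec.imp (fun h => ?_) fun h => ?_⟩
  · exact KSys.mem_D hPy hZ hYP (inter_subset_of_max hT' hrT' hP hY.2.1 hZ h)
  · exact KSys.mem_D hPy sdiff_subset hYP (inter_subset_of_max hT' hrT' hP hY.2.1 sdiff_subset h)
end

section
/- Let x ∈ 𝐊 satisfy: (a) 𝒜^x_η ≠ {{η}} for every η ∈ M_x and ℬ_x is ℵ₁-directed under ≤_x; (b) for every B ∈ ℬ_x and every front Y of B, D^x_Y is an ultrafilter on Y, non-principal iff Y ≠ {rt_x}; (c) for every B₁ ∈ ℬ_x there is B₂ ∈ ℬ_x with B₁ ≤_x B₂, B₁ ∩ suc_{B₂}(rt_x) = ∅, and for every ϱ ∈ suc_{B₂}(rt_x) infinitely many ρ ∈ suc_{B₁}(rt_x) satisfy ϱ ≤_{M_x} ρ; and (d) x is large. Then for every antichain Y of M_x that is an almost front of some member of ℬ_x, there is no P-point below D^x_Y: there is no function h with domain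 Y and range ⊆ ℕ such that the pushforward h(D^x_Y) = {A ⊆ ℕ : h⁻¹[A] ∈ D^x_Y} is a P-point. -/
open Set Cardinal

universe u

variable {α : Type u}

section UltraDefs

/-- `D` is an ultrafilter on the set `Y`. -/
def IsUltraOn {β : Type*} (Y : Set β) (D : Set (Set β)) : Prop :=
  Y ∈ D ∧ ∅ ∉ D ∧ (∀ Z ∈ D, Z ⊆ Y) ∧
  (∀ Z₁ ∈ D, ∀ Z₂ ∈ D, Z₁ ∩ Z₂ ∈ D) ∧
  (∀ Z₁ ∈ D, ∀ Z₂, Z₁ ⊆ Z₂ → Z₂ ⊆ Y → Z₂ ∈ D) ∧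
  (∀ Z, Z ⊆ Y → Z ∈ D ∨ Y \ Z ∈ D)

/-- `D` is a principal (ultra)filter on the set `Y`. -/
def IsPrincipalOn {β : Type*} (Y : Set β) (D : Set (Set β)) : Prop :=
  ∃ a ∈ Y, D = {Z | Z ⊆ Y ∧ a ∈ Z}

/-- `D` is a `Q`-point on the countable set `Y`: an ultrafilter such that every function
which is finite-to-one on `Y` is one-to-one on some member of `D`. -/
def IsQPoint {β : Type*} (Y : Set β) (D : Set (Set β)) : Prop :=
  Y.Countable ∧ IsUltraOn Y D ∧
  ∀ f : β → ℕ, (∀ n, {y ∈ Y | f y = n}.Finite) → ∃ A ∈ D, Set.InjOn f A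

/-- `D` is a `P`-point: a non-principal ultrafilter on `ℕ` such that every countable
subfamily has a pseudo-intersection in `D`. -/
def IsPPoint (D : Set (Set ℕ)) : Prop :=
  IsUltraOn Set.univ D ∧ ¬IsPrincipalOn Set.univ D ∧
  ∀ 𝒞 : Set (Set ℕ), 𝒞 ⊆ D → 𝒞.Countable → ∃ A ∈ D, ∀ C ∈ 𝒞, (A \ C).Finite

end UltraDefs

section Properties

variable [PartialOrder α]

namespace KSys

/-- `x` is fat. -/
def Fat (x : KSys α) : Prop :=
  ∀ B ∈ x.Bf, ∀ B', sb x.M B B' →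
    ∃ B'', sb x.M B' B'' ∧ B'' ∈ x.Bf ∧ x.lex B B''

/-- `x` is big. -/
def Big (x : KSys α) : Prop :=
  ∀ B ∈ x.Bf, ∀ c : α → Bool,
    ∃ B', psb x.M B B' ∧ B' ∈ x.Bf ∧ x.lex B B' ∧
      ∀ η ∈ maxIn B', ∀ ν ∈ maxIn B', c η = c ν

/-- `x` is large. -/
def Large (x : KSys α) : Prop :=
  ∀ B ∈ x.Bf, ∀ (β : Type) (c : α → β),
    ∃ B', psb x.M B B' ∧ B' ∈ x.Bf ∧
      ∃ Y, IsFront B' Y ∧ ∀ η ∈ maxIn B', ∀ ν ∈ maxIn B',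
        (c η = c ν ↔ ∃ ρ ∈ Y, ρ ≤ η ∧ ρ ≤ ν)

/-- `x` is full. -/
def Full (x : KSys α) : Prop :=
  ∀ η ∈ x.M, η ≠ x.rt → ∀ B ∈ x.A η, ∀ B', psb x.M B B' → B' ∈ x.A η

end KSys

end Properties

section Trees

variable [PartialOrder α] {M B P S Y Z : Set α}

theorem succIn_of_lower (hPB : P ⊆ B) (hlow : ∀ ν ∈ P, ∀ η ∈ B, η ≤ ν → η ∈ P) (ν : α) :
    succIn P ν = succIn B ν ∩ P := by
  ext ρ
  constructor
  · rintro ⟨hρ, hlt, hno⟩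
    exact ⟨⟨hPB hρ, hlt, fun ⟨σ, hσ, h1, h2⟩ => hno ⟨σ, hlow ρ hρ σ hσ h2.le, h1, h2⟩⟩, hρ⟩
  · rintro ⟨⟨_, hlt, hno⟩, hρ⟩
    exact ⟨hρ, hlt, fun ⟨σ, hσ, h1, h2⟩ => hno ⟨σ, hPB hσ, h1, h2⟩⟩

theorem CWT.exists_le_maxIn (hB : CWT M B) {ν : α} (hν : ν ∈ B) : ∃ μ ∈ maxIn B, ν ≤ μ := by
  obtain ⟨-, -, -, -, hch, -⟩ := hB
  obtain ⟨m, hm, hmax⟩ := zorn_le_nonempty₀ B (fun c hc hchain y hy => by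
    obtain ⟨u, hu⟩ := (hch c hc hchain).exists_maximal ⟨y, hy⟩
    refine ⟨u, hc hu.1, fun z hz => ?_⟩
    rcases hchain.total hz hu.1 with h | h
    · exact h
    · exact hu.2 hz h) ν hν
  exact ⟨m, ⟨hmax.1, fun z hz hlt => hlt.not_ge (hmax.2 hz hlt.le)⟩, hm⟩

theorem CWT.exists_succIn_le (hB : CWT M B) {ν η : α} (hη : η ∈ B) (hlt : ν < η) :
    ∃ s ∈ succIn B ν, s ≤ η := by
  obtain ⟨-, -, -, htree, hch, -⟩ := hB
  have hfin : {σ ∈ B | ν < σ ∧ σ ≤ η}.Finite := by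
    refine hch _ (fun σ h => h.1) ?_
    rintro a ⟨ha, -, ha'⟩ b ⟨hb, -, hb'⟩ -
    exact htree η hη a ha b hb ha' hb'
  obtain ⟨s, hs⟩ := hfin.exists_minimal ⟨η, hη, hlt, le_rfl⟩
  refine ⟨s, ⟨hs.1.1, hs.1.2.1, ?_⟩, hs.1.2.2⟩
  rintro ⟨σ, hσ, h1, h2⟩
  exact h2.not_ge (hs.2 ⟨hσ, h1, h2.le.trans hs.1.2.2⟩ h2.le)

theorem CWT.lower_of_succIn_subset (hB : CWT M B) (hP : CWT M P) (hPB : P ⊆ B)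
    (hr : ∃ r, IsRoot B r ∧ IsRoot P r) (hs : ∀ ν ∈ P \ maxIn B, succIn P ν ⊆ succIn B ν) :
    ∀ ν ∈ P, ∀ η ∈ B, η ≤ ν → η ∈ P := by
  intro ν hν η hη hle
  obtain ⟨-, -, -, htree, hch, -⟩ := id hB
  obtain ⟨r, hrB, hrP⟩ := hr
  have hfin : {σ ∈ P | σ ≤ η}.Finite := by
    refine hch _ (fun σ h => hPB h.1) ?_
    rintro a ⟨ha, ha'⟩ b ⟨hb, hb'⟩ -
    exact htree η hη a (hPB ha) b (hPB hb) ha' hb'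
  obtain ⟨σ, hσ⟩ := hfin.exists_maximal ⟨r, hrP.1, hrB.2 η hη⟩
  rcases hσ.1.2.eq_or_lt with h | h
  · exact h ▸ hσ.1.1
  · obtain ⟨s, hsP, hsν⟩ := hP.exists_succIn_le hν (h.trans_le hle)
    have hsB := hs σ ⟨hσ.1.1, fun hm => hm.2 η hη h⟩ hsP
    rcases htree ν (hPB hν) s hsB.1 η hη hsν hle with h' | h'
    · exact absurd (hσ.2 ⟨hsP.1, h'⟩ hsB.2.1.le) hsB.2.1.not_ge
    · rcases h'.eq_or_lt with h'' | h''
      · exact h'' ▸ hsP.1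
      · exact absurd ⟨η, hη, h, h''⟩ hsB.2.2

theorem CWT.infinite_succIn (hB : CWT M B) {ν : α} (hν : ν ∈ B) (hmax : ν ∉ maxIn B) :
    (succIn B ν).Infinite := by
  have : ∃ η ∈ B, ν < η := by
    by_contra! h
    exact hmax ⟨hν, h⟩
  obtain ⟨η, hη, hlt⟩ := this
  obtain ⟨s, hs, -⟩ := hB.exists_succIn_le hη hlt
  exact (hB.2.2.2.2.2.1 ν hν).resolve_left (Set.nonempty_iff_ne_empty.1 ⟨s, hs⟩)

theorem sb_of_lower (hB : CWT M B) (hPB : P ⊆ B) (hlow : ∀ ν ∈ P, ∀ η ∈ B, η ≤ ν → η ∈ P)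
    {r : α} (hr : IsRoot B r) (hrP : r ∈ P) (hfin : ∀ ν ∈ P, (succIn B ν \ P).Finite) :
    sb M B P := by
  have hsucc := succIn_of_lower hPB hlow
  have hrootP : IsRoot P r := ⟨hrP, fun y hy => hr.2 y (hPB hy)⟩
  obtain ⟨h1, h2, -, h4, h5, h6, h7, h8⟩ := hB
  refine ⟨⟨hPB.trans h1, h2.mono hPB, ⟨r, hrootP⟩, ?_, ?_, ?_, ?_, ?_⟩, hPB, ⟨r, hr, hrootP⟩, ?_⟩
  · exact fun ν hν η hη ρ hρ => h4 ν (hPB hν) η (hPB hη) ρ (hPB hρ)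
  · exact fun C hC => h5 C (hC.trans hPB)
  · intro ν hν
    rw [hsucc]
    rcases h6 ν (hPB hν) with h | h
    · left; rw [h, Set.empty_inter]
    · right
      have := h.sdiff (hfin ν hν)
      rwa [Set.sdiff_sdiff_right_self] at this
  · exact fun η hη ν hν => h7 η (hPB hη) ν (hPB hν)
  · rintro ν ⟨hν, hmax⟩ F hF
    have hν' : ν ∉ maxIn B := fun h => hmax ⟨hν, fun η hη => h.2 η (hPB hη)⟩
    refine ((h8 ν ⟨hPB hν, hν'⟩ F hF).sdiff (hfin ν hν)).mono ?_
    rintro ρ ⟨⟨hρ, hinc⟩, hn⟩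
    refine ⟨?_, hinc⟩
    rw [hsucc]
    exact ⟨hρ, by_contra fun h => hn ⟨hρ, h⟩⟩
  · intro ν hν
    rw [hsucc]
    refine ⟨Set.inter_subset_left, ?_⟩
    rw [Set.sdiff_self_inter]
    exact hfin ν hν

theorem sb.lower (hB : CWT M B) (h : sb M B P) : ∀ ν ∈ P, ∀ η ∈ B, η ≤ ν → η ∈ P :=
  hB.lower_of_succIn_subset h.1 h.2.1 h.2.2.1 fun ν hν => (h.2.2.2 ν hν.1).1

theorem sb.finite_diff (h : sb M B P) {ν : α} (hν : ν ∈ P) : (succIn B ν \ P).Finite :=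
  (h.2.2.2 ν hν).2.subset fun _ hs => ⟨hs.1, fun hs' => hs.2 hs'.1⟩

theorem psb.lower (hB : CWT M B) (h : psb M B P) : ∀ ν ∈ P, ∀ η ∈ B, η ≤ ν → η ∈ P :=
  hB.lower_of_succIn_subset h.1 h.2.1 h.2.2.1 fun ν hν => (h.2.2.2 ν hν).2

theorem sb_refl (hB : CWT M B) : sb M B B := by
  obtain ⟨r, hr⟩ := hB.2.2.1
  exact ⟨hB, subset_rfl, ⟨r, hr, hr⟩, fun ν _ => ⟨subset_rfl, by simp⟩⟩

theorem sb.maxIn_subset (hB : CWT M B) (h : sb M B P) : maxIn P ⊆ maxIn B := by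
  intro μ hμ
  by_contra hmax
  obtain ⟨s, hs, hn⟩ := ((hB.infinite_succIn (h.2.1 hμ.1) hmax).sdiff (h.finite_diff hμ.1)).nonempty
  exact hμ.2 s (by_contra fun hsP => hn ⟨hs, hsP⟩) hs.2.1

theorem psb.maxIn_subset (h : psb M B P) : maxIn P ⊆ maxIn B := by
  intro μ hμ
  by_contra hmax
  obtain ⟨s, hs⟩ := (h.2.2.2 μ ⟨hμ.1, hmax⟩).1.nonempty
  exact hμ.2 s hs.1 hs.2.1

/-- The intersection of an exhaustive subtree `S` of `B` with a subset `P` of `B` which is a tree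
and a lower set in `B` is an exhaustive subtree of `P`. -/
theorem sb.inter_of_lower (hB : CWT M B) (hS : sb M B S) (hP : CWT M P) (hPB : P ⊆ B)
    (hlow : ∀ ν ∈ P, ∀ η ∈ B, η ≤ ν → η ∈ P) : sb M P (P ∩ S) := by
  obtain ⟨r, hr, hrS⟩ := hS.2.2.1
  obtain ⟨p, hp⟩ := hP.2.2.1
  have hrP : r ∈ P := hlow p hp.1 r hr.1 (hr.2 p (hPB hp.1))
  refine sb_of_lower hP Set.inter_subset_left
    (fun ν hν η hη hle => ⟨hη, hS.lower hB ν hν.2 η (hPB hη) hle⟩)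
    (r := r) ⟨hrP, fun y hy => hr.2 y (hPB hy)⟩ ⟨hrP, hrS.1⟩ fun ν hν => ?_
  refine (hS.finite_diff hν.2).subset ?_
  rintro s ⟨hs, hn⟩
  rw [succIn_of_lower hPB hlow] at hs
  exact ⟨hs.1, fun h => hn ⟨hs.2, h⟩⟩

theorem sb.trans (hB : CWT M B) (hP : sb M B P) (hS : sb M P S) : sb M B S := by
  obtain ⟨r, hr, hrP⟩ := hP.2.2.1
  obtain ⟨r', hr', hrS⟩ := hS.2.2.1
  have hrS' : r ∈ S := hS.lower hP.1 r' hrS.1 r hrP.1 (hrP.2 r' hr'.1)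
  refine sb_of_lower hB (hS.2.1.trans hP.2.1) (fun ν hν η hη hle =>
    hS.lower hP.1 ν hν η (hP.lower hB ν (hS.2.1 hν) η hη hle) hle) hr hrS' fun ν hν => ?_
  refine ((hP.finite_diff (hS.2.1 hν)).union (hS.finite_diff hν)).subset ?_
  rintro s ⟨hs, hn⟩
  by_cases hsP : s ∈ P
  · right
    rw [succIn_of_lower hP.2.1 (hP.lower hB)]
    exact ⟨⟨hs, hsP⟩, hn⟩
  · exact Or.inl ⟨hs, hsP⟩

theorem sb.inter (hB : CWT M B) (hP : sb M B P) (hS : sb M B S) : sb M B (P ∩ S) :=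
  hP.trans hB (hS.inter_of_lower hB hP.1 hP.2.1 (hP.lower hB))

/-- Cutting off the cones above a set which meets every set of immediate successors in a finite
set leaves an exhaustive subtree. -/
theorem sb_remove_cones (hB : CWT M B) {r : α} (hr : IsRoot B r) {F : Set α} (hF : F ⊆ B)
    (hrF : r ∉ F) (hfin : ∀ ν ∈ B, (succIn B ν ∩ F).Finite) :
    sb M B {b ∈ B | ∀ f ∈ F, ¬f ≤ b} := by
  refine sb_of_lower hB (fun b hb => hb.1)
    (fun ν hν η hη hle => ⟨hη, fun f hf h => hν.2 f hf (h.trans hle)⟩) hr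
    ⟨hr.1, fun f hf h => hrF (le_antisymm h (hr.2 f (hF hf)) ▸ hf)⟩ fun ν hν => ?_
  refine (hfin ν hν.1).subset ?_
  rintro s ⟨hs, hn⟩
  have : ∃ f ∈ F, f ≤ s := by
    by_contra! h
    exact hn ⟨hs.1, h⟩
  obtain ⟨f, hf, hfs⟩ := this
  have hνf : ν < f := by
    rcases hB.2.2.2.1 s hs.1 f (hF hf) ν hν.1 hfs hs.2.1.le with h | h
    · exact absurd h (hν.2 f hf)
    · exact lt_of_le_of_ne h fun h' => hν.2 f hf h'.ge
  rcases hfs.eq_or_lt with h | h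
  · exact ⟨hs, h ▸ hf⟩
  · exact absurd ⟨f, hF hf, hνf, h⟩ hs.2.2

theorem IsFront.inter_of_lower (hB : CWT M B) (hY : IsFront B Y) (hP : CWT M P) (hPB : P ⊆ B)
    (hlow : ∀ ν ∈ P, ∀ η ∈ B, η ≤ ν → η ∈ P) (hmax : maxIn P ⊆ maxIn B) :
    IsFront P (Y ∩ P) := by
  refine ⟨Set.inter_subset_right, fun η hη ν hν => hY.2.1 η hη.1 ν hν.1, fun ν hν => ?_⟩
  obtain ⟨μ, hμ, hle⟩ := hP.exists_le_maxIn hν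
  obtain ⟨y, hy, hc⟩ := hY.2.2 μ (hPB hμ.1)
  have hyμ : y ≤ μ := by
    rcases hc with h | h
    · exact h
    · rcases h.eq_or_lt with h' | h'
      · exact h'.ge
      · exact absurd h' ((hmax hμ).2 y (hY.1 hy))
  exact ⟨y, ⟨hy, hlow μ hμ.1 y (hY.1 hy) hyμ⟩,
    hB.2.2.2.1 μ (hPB hμ.1) y (hY.1 hy) ν (hPB hν) hyμ hle⟩

theorem IsFront.isAlmostFront (hB : CWT M B) (hY : IsFront B Y) : IsAlmostFront M B Y :=
  ⟨hY.1.trans hB.1, hY.2.1, B, sb_refl hB, by rwa [Set.inter_eq_left.2 hY.1]⟩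

theorem isFront_maxIn (hB : CWT M B) : IsFront B (maxIn B) := by
  refine ⟨fun y hy => hy.1, fun η hη ν hν hne hle => hη.2 ν hν.1 (lt_of_le_of_ne hle hne),
    fun ν hν => ?_⟩
  obtain ⟨μ, hμ, hle⟩ := hB.exists_le_maxIn hν
  exact ⟨μ, hμ, Or.inr hle⟩

theorem IsAlmostFront.of_psb (hB : CWT M B) (hY : IsAlmostFront M B Y) (hP : psb M B P) :
    IsAlmostFront M P Y := by
  obtain ⟨hYM, hanti, S, hS, hYS⟩ := hY
  have hPS := hS.inter_of_lower hB hP.1 hP.2.1 (hP.lower hB)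
  refine ⟨hYM, hanti, P ∩ S, hPS, ?_⟩
  have hmax : maxIn (P ∩ S) ⊆ maxIn S := fun μ hμ =>
    ⟨hμ.1.2, fun η hη => (hP.maxIn_subset (hPS.maxIn_subset hP.1 hμ)).2 η (hS.2.1 hη)⟩
  have := hYS.inter_of_lower hS.1 hPS.1 Set.inter_subset_right
    (fun ν hν η hη hle => ⟨hP.lower hB ν hν.1 η (hS.2.1 hη) hle, hη⟩) hmax
  rwa [Set.inter_assoc, Set.inter_eq_right.2 (Set.inter_subset_right : P ∩ S ⊆ S)] at this

theorem IsAlmostFront.inter_sb (hB : CWT M B) (hY : IsAlmostFront M B Y) (hP : sb M B P) :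
    IsAlmostFront M B (Y ∩ P) := by
  obtain ⟨hYM, hanti, S, hS, hYS⟩ := hY
  have hSP := hP.inter_of_lower hB hS.1 hS.2.1 (hS.lower hB)
  refine ⟨fun y hy => hYM hy.1, fun η hη ν hν => hanti η hη.1 ν hν.1, S ∩ P,
    hS.trans hB hSP, ?_⟩
  have := hYS.inter_of_lower hS.1 hSP.1 Set.inter_subset_left (hSP.lower hS.1)
    (hSP.maxIn_subset hS.1)
  convert this using 1
  ext y
  simp only [Set.mem_inter_iff]
  tauto

theorem IsAlmostFront.of_leStar {B₁ B₂ : Set α} (hY : IsAlmostFront M B₁ Y)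
    (h : leStar M B₁ B₂) : IsAlmostFront M B₂ Y := by
  obtain ⟨h1, -, -, P, -, hpsb, htr⟩ := h
  exact htr Y (hY.of_psb h1 hpsb)

theorem IsAlmostFront.exists_sb (hY : IsAlmostFront M B Y) :
    ∃ S, sb M B S ∧ ∀ μ ∈ S ∩ maxIn B, ∃ y ∈ Y, y ∈ B ∧ y ≤ μ := by
  obtain ⟨-, -, S, hS, hYS⟩ := hY
  refine ⟨S, hS, fun μ hμ => ?_⟩
  obtain ⟨y, hy, hc⟩ := hYS.2.2 μ hμ.1
  have hyB := hS.2.1 hy.2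
  refine ⟨y, hy.1, hyB, ?_⟩
  rcases hc with h | h
  · exact h
  · rcases h.eq_or_lt with h' | h'
    · exact h'.ge
    · exact absurd h' (hμ.2.2 y hyB)

end Trees

namespace KSys

variable [PartialOrder α] (x : KSys α)

theorem cwt_of_mem_Bf {B : Set α} (hB : B ∈ x.Bf) : CWT x.M B :=
  x.A_cwt x.rt x.rt_mem B hB.1

theorem isRoot_of_mem_Bf {B : Set α} (hB : B ∈ x.Bf) : IsRoot B x.rt :=
  x.A_root x.rt x.rt_mem B hB.1

theorem exists_almostFront_of_mem_D {Y Z : Set α} (hZ : Z ∈ x.D Y) :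
    ∃ B ∈ x.Bf, ∃ Z₀ ⊆ Z, Z₀ ⊆ Y ∧ IsAlmostFront x.M B Z₀ := by
  obtain ⟨-, B, hB, S, hS, hY, hsub⟩ := hZ
  exact ⟨B, hB, Y ∩ S, fun y hy => hsub ⟨hy.2, hy.1⟩, Set.inter_subset_left,
    hY.inter_sb (x.cwt_of_mem_Bf hB) hS⟩

/-- No map that is injective on a front `Y` pushes the ultrafilter `D_Y` onto a `P`-point. -/
theorem not_isPPoint_of_injOn
    (hc : ∀ B₁ ∈ x.Bf, ∃ B₂ ∈ x.Bf, x.lex B₁ B₂ ∧ B₁ ∩ succIn B₂ x.rt = ∅)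
    {B Y : Set α} (hB : B ∈ x.Bf) (hY : IsFront B Y) (hult : IsUltraOn Y (x.D Y))
    (hrt : x.rt ∉ Y) {g : α → ℕ} (hg : Set.InjOn g Y) {U : Set (Set ℕ)}
    (hU : ∀ A ∈ U, {y ∈ Y | g y ∈ A} ∈ x.D Y) : ¬IsPPoint U := by
  rintro ⟨hUult, -, hpseudo⟩
  obtain ⟨B₂, hB₂, hlex, hdisj⟩ := hc B hB
  have hcwt := x.cwt_of_mem_Bf hB₂
  have hroot := x.isRoot_of_mem_Bf hB₂
  have hY₂ : IsAlmostFront x.M B₂ Y :=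
    (hY.isAlmostFront (x.cwt_of_mem_Bf hB)).of_leStar (x.lex_leStar _ _ hlex)
  obtain ⟨-, hempty, -, hinter, -, -⟩ := hult
  have hcone : ∀ ϱ ∈ succIn B₂ x.rt, {n | ∃ y ∈ Y, ϱ ≤ y ∧ g y = n}ᶜ ∈ U := by
    intro ϱ hϱ
    have hmem : {y ∈ Y | ¬ϱ ≤ y} ∈ x.D Y := by
      refine ⟨fun y hy => hy.1, B₂, hB₂, _, sb_remove_cones hcwt hroot (F := {ϱ})
        (by simpa using hϱ.1) (by simpa using hϱ.2.1.ne)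
        (fun ν _ => (Set.finite_singleton ϱ).subset Set.inter_subset_right), hY₂, ?_⟩
      rintro y ⟨hy, hyY⟩
      exact ⟨hyY, hy.2 ϱ rfl⟩
    rcases hUult.2.2.2.2.2 {n | ∃ y ∈ Y, ϱ ≤ y ∧ g y = n} (Set.subset_univ _) with h | h
    · refine absurd (hinter _ (hU _ h) _ hmem) ?_
      convert hempty
      rw [Set.eq_empty_iff_forall_notMem]
      rintro y ⟨⟨hy, z, hz, hle, heq⟩, -, hn⟩
      exact hn (hg hz hy heq ▸ hle)
    · rwa [Set.compl_eq_univ_sdiff]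
  obtain ⟨A, hA, hAfin⟩ := hpseudo
    ((fun ϱ => {n | ∃ y ∈ Y, ϱ ≤ y ∧ g y = n}ᶜ) '' succIn B₂ x.rt)
    (by rintro _ ⟨ϱ, hϱ, rfl⟩; exact hcone ϱ hϱ)
    ((hcwt.2.1.mono fun _ h => h.1).image _)
  have hfin : ∀ ϱ ∈ succIn B₂ x.rt, {y ∈ Y | g y ∈ A ∧ ϱ ≤ y}.Finite := by
    intro ϱ hϱ
    refine Set.Finite.of_finite_image ((hAfin _ ⟨ϱ, hϱ, rfl⟩).subset ?_)
      (hg.mono fun _ h => h.1)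
    rintro _ ⟨y, ⟨hy, hyA, hle⟩, rfl⟩
    exact ⟨hyA, fun h => h ⟨y, hy, hle, rfl⟩⟩
  have hsb := sb_remove_cones hcwt hroot (F := {y ∈ Y | g y ∈ A} ∩ B₂) Set.inter_subset_right
    (fun h => hrt h.1.1) (by
      intro ν hν
      rcases (hroot.2 ν hν).eq_or_lt with rfl | hlt
      · convert Set.finite_empty
        rw [Set.eq_empty_iff_forall_notMem]
        rintro s ⟨hs, ⟨hsY, -⟩, -⟩
        exact hdisj.subset ⟨hY.1 hsY, hs⟩
      · obtain ⟨ϱ, hϱ, hle⟩ := hcwt.exists_succIn_le hν hlt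
        refine (hfin ϱ hϱ).subset ?_
        rintro s ⟨hs, hsY, -⟩
        exact ⟨hsY.1, hsY.2, hle.trans hs.2.1.le⟩)
  have hmem : Y \ {y ∈ Y | g y ∈ A} ∈ x.D Y := by
    refine ⟨Set.sdiff_subset, B₂, hB₂, _, hsb, hY₂, ?_⟩
    rintro y ⟨hy, hyY⟩
    exact ⟨hyY, fun h => hy.2 y ⟨h, hy.1⟩ le_rfl⟩
  have := hinter _ (hU A hA) _ hmem
  rw [Set.inter_sdiff_self] at this
  exact hempty this

end KSys

/-- if `x ∈ 𝐊` satisfies conditions (a)-(c) of the main theorem and is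
large, then for every almost front `Y` of a member of `ℬ_x` there is no `P`-point below
`D^x_Y`: no map `h : Y → ℕ` pushes `D^x_Y` onto a `P`-point. -/
theorem no_PPoint_below [PartialOrder α] (x : KSys α)
    (ha₁ : ∀ η ∈ x.M, x.A η ≠ {({η} : Set α)})
    (ha₂ : ∀ S ⊆ x.Bf, S.Countable → ∃ B ∈ x.Bf, ∀ B' ∈ S, x.lex B' B)
    (hb : ∀ B ∈ x.Bf, ∀ Y, IsFront B Y →
      IsUltraOn Y (x.D Y) ∧ (¬IsPrincipalOn Y (x.D Y) ↔ Y ≠ ({x.rt} : Set α)))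
    (hc : ∀ B₁ ∈ x.Bf, ∃ B₂ ∈ x.Bf, x.lex B₁ B₂ ∧ B₁ ∩ succIn B₂ x.rt = ∅ ∧
      ∀ ϱ ∈ succIn B₂ x.rt, {ρ ∈ succIn B₁ x.rt | ϱ ≤ ρ}.Infinite)
    (hd : x.Large)
    (B Y : Set α) (hB : B ∈ x.Bf) (hY : IsAlmostFront x.M B Y) :
    ¬∃ h : α → ℕ, IsPPoint {A : Set ℕ | {y ∈ Y | h y ∈ A} ∈ x.D Y} := by
  classical
  rintro ⟨h, hP⟩
  have hBc := x.cwt_of_mem_Bf hB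
  obtain ⟨B₀, hB₀, hYB₀⟩ := hY.2.2
  let c : α → ℕ := fun η => if hη : ∃ y ∈ Y ∩ B₀, y ≤ η then h hη.choose else 0
  obtain ⟨B', hpsb, hB', Y', hY', hc'⟩ := hd B hB ℕ c
  have hB'c := x.cwt_of_mem_Bf hB'
  have hcη : ∀ η ∈ B, ∀ y ∈ Y ∩ B₀, y ≤ η → c η = h y := by
    intro η hη y hy hle
    have hex : ∃ y ∈ Y ∩ B₀, y ≤ η := ⟨y, hy, hle⟩
    have hs := hex.choose_spec
    have heq : hex.choose = y := by
      by_contra hne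
      rcases hBc.2.2.2.1 η hη _ (hB₀.2.1 hs.1.2) y (hB₀.2.1 hy.2) hs.2 hle with h' | h'
      · exact hY.2.1 _ hs.1.1 y hy.1 hne h'
      · exact hY.2.1 y hy.1 _ hs.1.1 (Ne.symm hne) h'
    simp only [c, dif_pos hex, heq]
  have hup : ∀ y ∈ Y', ∃ μ ∈ maxIn B', y ≤ μ := fun y hy => hB'c.exists_le_maxIn (hY'.1 hy)
  choose! m hm hle using hup
  have huniq : ∀ η ∈ B', ∀ y ∈ Y', ∀ z ∈ Y', y ≤ η → z ≤ η → y = z := by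
    intro η hη y hy z hz h1 h2
    by_contra hne
    rcases hB'c.2.2.2.1 η hη y (hY'.1 hy) z (hY'.1 hz) h1 h2 with h' | h'
    · exact hY'.2.1 y hy z hz hne h'
    · exact hY'.2.1 z hz y hy (Ne.symm hne) h'
  have hinj : Set.InjOn (fun y => c (m y)) Y' := by
    intro y hy z hz heq
    obtain ⟨ρ, hρ, h1, h2⟩ := (hc' _ (hm y hy) _ (hm z hz)).1 heq
    rw [huniq _ (hm y hy).1 y hy ρ hρ (hle y hy) h1, huniq _ (hm z hz).1 z hz ρ hρ (hle z hz) h2]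
  have hult := (hb B' hB' Y' hY').1
  have hpush : ∀ A ∈ {A : Set ℕ | {y ∈ Y | h y ∈ A} ∈ x.D Y},
      {y ∈ Y' | c (m y) ∈ A} ∈ x.D Y' := by
    intro A hA
    refine (hult.2.2.2.2.2 _ (fun y hy => hy.1)).resolve_right fun hcompl => ?_
    obtain ⟨B₃, hB₃, Z₁, hZ₁, hZ₁Y, haf₁⟩ := x.exists_almostFront_of_mem_D hA
    obtain ⟨B₄, hB₄, Z₂, hZ₂, hZ₂Y, haf₂⟩ := x.exists_almostFront_of_mem_D hcompl
    obtain ⟨E, hE, hlexE⟩ := ha₂ {B₃, B₄, B'}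
      (by rintro _ (rfl | rfl | rfl) <;> assumption) (Set.toFinite _).countable
    have hEc := x.cwt_of_mem_Bf hE
    have hle₃ := x.lex_leStar _ _ (hlexE B₃ (by simp))
    have hle₄ := x.lex_leStar _ _ (hlexE B₄ (by simp))
    have hle' := x.lex_leStar _ _ (hlexE B' (by simp))
    have hYB' : IsAlmostFront x.M B' (Y ∩ (B' ∩ B₀)) := (hY.of_psb hBc hpsb).inter_sb hB'c
      (hB₀.inter_of_lower hBc hB'c hpsb.2.1 (hpsb.lower hBc))
    obtain ⟨S₁, hS₁, hs₁⟩ := (haf₁.of_leStar hle₃).exists_sb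
    obtain ⟨S₂, hS₂, hs₂⟩ := (haf₂.of_leStar hle₄).exists_sb
    obtain ⟨S₃, hS₃, hs₃⟩ := (hYB'.of_leStar hle').exists_sb
    obtain ⟨S₄, hS₄, hs₄⟩ :=
      (((isFront_maxIn hB'c).isAlmostFront hB'c).of_leStar hle').exists_sb
    have hS := ((hS₁.inter hEc hS₂).inter hEc hS₃).inter hEc hS₄
    obtain ⟨r, -, hr⟩ := hS.2.2.1
    obtain ⟨μ, hμ, -⟩ := hS.1.exists_le_maxIn hr.1
    have hμE := hS.maxIn_subset hEc hμ
    obtain ⟨⟨⟨⟨hμ₁, hμ₂⟩, hμ₃⟩, hμ₄⟩, -⟩ := hμ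
    obtain ⟨z₁, hz₁, hz₁E, hz₁μ⟩ := hs₁ μ ⟨hμ₁, hμE⟩
    obtain ⟨z₂, hz₂, hz₂E, hz₂μ⟩ := hs₂ μ ⟨hμ₂, hμE⟩
    obtain ⟨z₃, hz₃, hz₃E, hz₃μ⟩ := hs₃ μ ⟨hμ₃, hμE⟩
    obtain ⟨η, hη, hηE, hημ⟩ := hs₄ μ ⟨hμ₄, hμE⟩
    have htree := hEc.2.2.2.1 μ hμE.1
    have h13 : z₁ = z₃ := by
      by_contra hne
      rcases htree z₁ hz₁E z₃ hz₃E hz₁μ hz₃μ with h' | h'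
      · exact hY.2.1 _ (hZ₁Y hz₁) _ hz₃.1 hne h'
      · exact hY.2.1 _ hz₃.1 _ (hZ₁Y hz₁) (Ne.symm hne) h'
    have hbelow : ∀ z ∈ B', z ∈ E → z ≤ μ → z ≤ η := by
      intro z hz hzE hzμ
      rcases htree z hzE η hηE hzμ hημ with h' | h'
      · exact h'
      · rcases h'.eq_or_lt with h'' | h''
        · exact h''.ge
        · exact absurd h'' (hη.2 z hz)
    have hcA : c η ∈ A := by
      rw [hcη η (hpsb.2.1 hη.1) z₃ ⟨hz₃.1, hz₃.2.2⟩ (hbelow z₃ hz₃.2.1 hz₃E hz₃μ), ← h13]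
      exact (hZ₁ hz₁).2
    have hz₂Y := hZ₂Y hz₂
    refine (hZ₂ hz₂).2 ⟨hz₂Y, ?_⟩
    rwa [(hc' _ (hm z₂ hz₂Y) η hη).2
      ⟨z₂, hz₂Y, hle z₂ hz₂Y, hbelow z₂ (hY'.1 hz₂Y) hz₂E hz₂μ⟩]
  have hrt : x.rt ∉ Y' := by
    intro hrt
    have hall : ∀ y ∈ Y', y = x.rt := fun y hy =>
      huniq y (hY'.1 hy) y hy x.rt hrt le_rfl (x.rt_least y (hB'c.1 (hY'.1 hy)))
    have hmem : ∀ A ∈ {A : Set ℕ | {y ∈ Y | h y ∈ A} ∈ x.D Y}, c (m x.rt) ∈ A := by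
      intro A hA
      by_contra hn
      refine hult.2.1 ?_
      convert hpush A hA
      symm
      rw [Set.eq_empty_iff_forall_notMem]
      rintro y ⟨hy, hyA⟩
      exact hn (hall y hy ▸ hyA)
    refine hP.2.1 ⟨c (m x.rt), Set.mem_univ _, Set.ext fun A =>
      ⟨fun hA => ⟨Set.subset_univ _, hmem A hA⟩, fun hA => ?_⟩⟩
    refine (hP.1.2.2.2.2.2 A (Set.subset_univ _)).resolve_right fun hA' => ?_
    exact (hmem _ hA').2 hA.2
  exact x.not_isPPoint_of_injOn
    (fun B₁ hB₁ => (hc B₁ hB₁).imp fun _ h => ⟨h.1, h.2.1, h.2.2.1⟩)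
    hB' hY' hult hrt hinj hpush hP
end
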